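/- Let X be a Banach space with a basis and suppose that all asymptotic models of X generated by block basic arrays (with respect to that basis) are equivalent to one another. Then every such asymptotic model is equivalent to the unit vector basis of c₀ or of ℓ_p for some 1 ≤ p < ∞. -/

import Mathlib

open Filter Finset Topology

variable {X : Type*} [NormedAddCommGroup X] [NormedSpace ℝ X]
variable {E : Type*} [NormedAddCommGroup E] [NormedSpace ℝ E]

/-- `(x i)` is a `C`-basic sequence. -/
def IsCBasic (C : ℝ) (x : ℕ → X) : Prop :=
  (∀ i, x i ≠ 0) ∧
    ∀ n m : ℕ, n < m → ∀ a : ℕ → ℝ,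
      ‖∑ i ∈ Finset.range n, a i • x i‖ ≤ C * ‖∑ i ∈ Finset.range m, a i • x i‖

/-- The finite sequence `y 0, …, y (m-1)` is `C`-basic. -/
def IsCBasicUpTo (C : ℝ) (m : ℕ) (y : ℕ → X) : Prop :=
  (∀ j, j < m → y j ≠ 0) ∧
    ∀ n k : ℕ, n < k → k ≤ m → ∀ a : ℕ → ℝ,
      ‖∑ i ∈ Finset.range n, a i • y i‖ ≤ C * ‖∑ i ∈ Finset.range k, a i • y i‖

/-- `(x i)` is normalized. -/
def Normalized (x : ℕ → X) : Prop := ∀ i, ‖x i‖ = 1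

/-- `x` is a `K`-basic array: each row `x n` is a normalized `K`-basic sequence and every
"diagonal" sequence `(x j (i j))_{j<m}` with `m ≤ i 0 < i 1 < ⋯` is `K`-basic. -/
def IsBasicArrayWith (K : ℝ) (x : ℕ → ℕ → X) : Prop :=
  (∀ n, Normalized (x n) ∧ IsCBasic K (x n)) ∧
    ∀ (m : ℕ) (i : ℕ → ℕ), StrictMono i → m ≤ i 0 →
      IsCBasicUpTo K m fun j => x j (i j)

/-- `x` is a basic array if it is a `K`-basic array for some `K`. -/
def IsBasicArray (x : ℕ → ℕ → X) : Prop := ∃ K : ℝ, IsBasicArrayWith K x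

/-- `y` is a (normalized or not) block basis of `x`. -/
def IsBlockBasisOf (x y : ℕ → X) : Prop :=
  ∃ (p : ℕ → ℕ) (b : ℕ → ℝ), StrictMono p ∧ (∀ j, y j ≠ 0) ∧
    ∀ j, y j = ∑ l ∈ Finset.Ico (p j) (p (j + 1)), b l • x l

/-- The finite sequence `y 0, …, y (m-1)` is a block basis of `x`. -/
def IsBlockBasisUpTo (m : ℕ) (x y : ℕ → X) : Prop :=
  ∃ (p : ℕ → ℕ) (b : ℕ → ℝ), StrictMono p ∧ (∀ j, j < m → y j ≠ 0) ∧
    ∀ j, j < m → y j = ∑ l ∈ Finset.Ico (p j) (p (j + 1)), b l • x l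

/-- `x` is a block basic array with respect to `x0`: it is a basic array, each row is a
block basis of `x0`, and every diagonal `(x j (i j))_{j<m}` with `m ≤ i 0 < i 1 < ⋯`
is a block basis of `x0`. -/
def IsBlockBasicArray (x0 : ℕ → X) (x : ℕ → ℕ → X) : Prop :=
  IsBasicArray x ∧ (∀ n, IsBlockBasisOf x0 (x n)) ∧
    ∀ (m : ℕ) (i : ℕ → ℕ), StrictMono i → m ≤ i 0 →
      IsBlockBasisUpTo m x0 fun j => x j (i j)

/-- `IteratedLimit n f L`: the iterated limit `lim_{i₀→∞} ⋯ lim_{i_{n-1}→∞} f (i₀, …, i_{n-1})`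
exists and equals `L`. -/
def IteratedLimit : ∀ n : ℕ, ((Fin n → ℕ) → ℝ) → ℝ → Prop
  | 0, f, L => f (fun i => i.elim0) = L
  | n + 1, f, L => ∃ g : ℕ → ℝ,
      (∀ i₀ : ℕ, IteratedLimit n (fun t => f (Fin.cons i₀ t)) (g i₀)) ∧
      Filter.Tendsto g Filter.atTop (nhds L)

/-- The array `y` in `X` generates the asymptotic model `e`: all the iterated limits
`lim_{i₀→∞} ⋯ lim_{i_{n-1}→∞} ‖∑_{j<n} b j • y j (i j)‖` exist and equal
`‖∑_{j<n} b j • e j‖`. -/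
def GeneratesAsymptoticModel (y : ℕ → ℕ → X) (e : ℕ → E) : Prop :=
  ∀ (n : ℕ) (b : ℕ → ℝ),
    IteratedLimit n (fun t => ‖∑ j : Fin n, b (j : ℕ) • y (j : ℕ) (t j)‖)
      ‖∑ j ∈ Finset.range n, b j • e j‖

/-- `e` is an asymptotic model of `X`: it is a normalized basic sequence generated by
some basic array in `X`. -/
def IsAsymptoticModel (X : Type*) [NormedAddCommGroup X] [NormedSpace ℝ X]
    {E : Type*} [NormedAddCommGroup E] [NormedSpace ℝ E] (e : ℕ → E) : Prop :=
  Normalized e ∧ (∃ C : ℝ, IsCBasic C e) ∧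
    ∃ y : ℕ → ℕ → X, IsBasicArray y ∧ GeneratesAsymptoticModel y e

/-- `b` is a (Schauder) basis of the space: it is basic and its closed linear span is
everything. -/
def IsSchauderBasis (b : ℕ → X) : Prop :=
  (∃ C : ℝ, IsCBasic C b) ∧ Dense (Submodule.span ℝ (Set.range b) : Set X)

/-- `e` is an asymptotic model of `X` generated by a block basic array w.r.t. `b`. -/
def IsBlockGeneratedAsymptoticModel (b : ℕ → X) {E : Type*} [NormedAddCommGroup E]
    [NormedSpace ℝ E] (e : ℕ → E) : Prop :=
  Normalized e ∧ (∃ C : ℝ, IsCBasic C e) ∧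
    ∃ y : ℕ → ℕ → X, IsBlockBasicArray b y ∧ GeneratesAsymptoticModel y e

/-- The sequences `e` and `f` are equivalent. -/
def SeqEquiv {F : Type*} [NormedAddCommGroup F] [NormedSpace ℝ F]
    (e : ℕ → E) (f : ℕ → F) : Prop :=
  ∃ A B : ℝ, 0 < A ∧ 0 < B ∧ ∀ (n : ℕ) (c : ℕ → ℝ),
    A⁻¹ * ‖∑ i ∈ Finset.range n, c i • e i‖ ≤ ‖∑ i ∈ Finset.range n, c i • f i‖ ∧
      ‖∑ i ∈ Finset.range n, c i • f i‖ ≤ B * ‖∑ i ∈ Finset.range n, c i • e i‖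

/-- `e` is equivalent to the unit vector basis of `c₀`. -/
def EquivToC0Basis (e : ℕ → E) : Prop :=
  ∃ A B : ℝ, 0 < A ∧ 0 < B ∧ ∀ (n : ℕ) (c : ℕ → ℝ),
    A⁻¹ * (⨆ i ∈ Finset.range n, |c i|) ≤ ‖∑ i ∈ Finset.range n, c i • e i‖ ∧
      ‖∑ i ∈ Finset.range n, c i • e i‖ ≤ B * ⨆ i ∈ Finset.range n, |c i|

/-- `e` is equivalent to the unit vector basis of `ℓ_p`. -/
def EquivToLpBasis (p : ℝ) (e : ℕ → E) : Prop :=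
  ∃ A B : ℝ, 0 < A ∧ 0 < B ∧ ∀ (n : ℕ) (c : ℕ → ℝ),
    A⁻¹ * (∑ i ∈ Finset.range n, |c i| ^ p) ^ (1 / p) ≤ ‖∑ i ∈ Finset.range n, c i • e i‖ ∧
      ‖∑ i ∈ Finset.range n, c i • e i‖ ≤ B * (∑ i ∈ Finset.range n, |c i| ^ p) ^ (1 / p)


/-! ### Finitely supported coefficient sequences and block sequences -/

section Blocks

/-- The finitely supported sequence agreeing with `c` below `n` and vanishing from `n` on. -/
noncomputable def coeffBelow (n : ℕ) (c : ℕ → ℝ) : ℕ →₀ ℝ :=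
  ∑ i ∈ Finset.range n, Finsupp.single i (c i)

theorem coeffBelow_apply (n : ℕ) (c : ℕ → ℝ) (i : ℕ) :
    coeffBelow n c i = if i < n then c i else 0 := by
  simp [coeffBelow, Finsupp.finsetSum_apply, Finsupp.single_apply]

theorem linearCombination_coeffBelow (x : ℕ → X) (n : ℕ) (c : ℕ → ℝ) :
    Finsupp.linearCombination ℝ x (coeffBelow n c) = ∑ i ∈ Finset.range n, c i • x i := by
  simp [coeffBelow]

theorem coeffBelow_eq_self {c : ℕ →₀ ℝ} {n : ℕ} (h : ∀ i ∈ c.support, i < n) :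
    coeffBelow n c = c := by
  ext i
  rw [coeffBelow_apply]
  split_ifs with hi
  · rfl
  · by_contra h0
    exact hi (h i (Finsupp.mem_support_iff.2 (Ne.symm h0)))

theorem exists_support_lt (c : ℕ →₀ ℝ) : ∃ n, ∀ i ∈ c.support, i < n :=
  ⟨c.support.sup id + 1, fun _ hi => Nat.lt_succ_of_le (Finset.le_sup (f := id) hi)⟩

theorem linearCombination_eq_sum_range (x : ℕ → X) {c : ℕ →₀ ℝ} {n : ℕ}
    (h : ∀ i ∈ c.support, i < n) :
    Finsupp.linearCombination ℝ x c = ∑ i ∈ Finset.range n, c i • x i := by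
  rw [← linearCombination_coeffBelow, coeffBelow_eq_self h]

theorem IsCBasic.one_le {C : ℝ} {x : ℕ → X} (hx : IsCBasic C x) : 1 ≤ C := by
  have h := hx.2 1 2 (by norm_num) (fun i => if i = 0 then 1 else 0)
  have h0 : 0 < ‖x 0‖ := norm_pos_iff.2 (hx.1 0)
  simp at h
  by_contra hC
  nlinarith

theorem IsCBasic.norm_filter_lt_le {C : ℝ} {x : ℕ → X} (hx : IsCBasic C x) (d : ℕ →₀ ℝ)
    (P : ℕ) :
    ‖Finsupp.linearCombination ℝ x (d.filter (· < P))‖ ≤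
      C * ‖Finsupp.linearCombination ℝ x d‖ := by
  obtain ⟨n, hn⟩ := exists_support_lt d
  have h := hx.2 P (max n (P + 1)) (by omega) d
  rw [← linearCombination_coeffBelow, ← linearCombination_coeffBelow,
    coeffBelow_eq_self (c := d) (fun _ hi => lt_of_lt_of_le (hn _ hi) (le_max_left _ _))] at h
  convert h using 3
  ext i
  rw [coeffBelow_apply, Finsupp.filter_apply]

theorem IsCBasic.norm_filter_ge_le {C : ℝ} {x : ℕ → X} (hx : IsCBasic C x) (d : ℕ →₀ ℝ)
    (P : ℕ) :
    ‖Finsupp.linearCombination ℝ x (d.filter (fun i => ¬ i < P))‖ ≤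
      (1 + C) * ‖Finsupp.linearCombination ℝ x d‖ := by
  have h := hx.norm_filter_lt_le d P
  have h2 : Finsupp.linearCombination ℝ x (d.filter (fun i => ¬ i < P)) =
      Finsupp.linearCombination ℝ x d - Finsupp.linearCombination ℝ x (d.filter (· < P)) := by
    rw [eq_sub_iff_add_eq', ← map_add, Finsupp.filter_add_filter_not]
  rw [h2]
  refine (norm_sub_le _ _).trans ?_
  linarith

theorem IsCBasic.abs_coeff_le {C : ℝ} {x : ℕ → X} (hx : IsCBasic C x) (d : ℕ →₀ ℝ)
    (i : ℕ) : |d i| * ‖x i‖ ≤ 2 * C * ‖Finsupp.linearCombination ℝ x d‖ := by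
  have h1 := hx.norm_filter_lt_le d i
  have h2 := hx.norm_filter_lt_le d (i + 1)
  have h3 : d.filter (· < i + 1) = d.filter (· < i) + Finsupp.single i (d i) := by
    ext j
    simp only [Finsupp.filter_apply, Finsupp.add_apply, Finsupp.single_apply]
    rcases lt_trichotomy j i with h | h | h
    · simp [h, h.ne', Nat.lt_succ_of_lt h]
    · simp [h]
    · simp [h.ne, h.not_gt, (show ¬ j < i + 1 by omega)]
  rw [h3, map_add, Finsupp.linearCombination_single] at h2
  have h4 : ‖d i • x i‖ = |d i| * ‖x i‖ := by rw [norm_smul, Real.norm_eq_abs]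
  rw [← h4]
  have h5 := norm_sub_le (Finsupp.linearCombination ℝ x (d.filter (· < i)) + d i • x i)
    (Finsupp.linearCombination ℝ x (d.filter (· < i)))
  rw [add_sub_cancel_left] at h5
  linarith

theorem IsCBasic.linearCombination_ne_zero {C : ℝ} {x : ℕ → X} (hx : IsCBasic C x)
    {d : ℕ →₀ ℝ} (hd : d ≠ 0) : Finsupp.linearCombination ℝ x d ≠ 0 := by
  intro h0
  apply hd
  ext i
  have h := hx.abs_coeff_le d i
  rw [h0, norm_zero, mul_zero] at h
  have h1 : 0 < ‖x i‖ := norm_pos_iff.2 (hx.1 i)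
  have h2 : |d i| ≤ 0 := by
    by_contra h3
    push Not at h3
    nlinarith
  simpa using h2

/-- `γ` is a sequence of nonzero, finitely supported sequences with successive supports. -/
def SuccBlocks (γ : ℕ → ℕ →₀ ℝ) : Prop :=
  (∀ i, γ i ≠ 0) ∧ ∀ i j, i < j → ∀ a ∈ (γ i).support, ∀ b ∈ (γ j).support, a < b

namespace SuccBlocks

variable {γ : ℕ → ℕ →₀ ℝ}

theorem smul (h : SuccBlocks γ) {s : ℕ → ℝ} (hs : ∀ i, s i ≠ 0) :
    SuccBlocks fun i => s i • γ i :=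
  ⟨fun i => smul_ne_zero (hs i) (h.1 i), fun i j hij _ ha _ hb =>
    h.2 i j hij _ (Finsupp.support_smul ha) _ (Finsupp.support_smul hb)⟩

theorem exists_strictMono (h : SuccBlocks γ) :
    ∃ p : ℕ → ℕ, StrictMono p ∧
      ∀ j, ∀ a ∈ (γ j).support, p j ≤ a ∧ ∀ i, j < i → a < p i := by
  have hne : ∀ j, (γ j).support.Nonempty := fun j => Finsupp.support_nonempty_iff.2 (h.1 j)
  refine ⟨fun j => (γ j).support.min' (hne j), fun i j hij => ?_, fun j a ha => ⟨?_, ?_⟩⟩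
  · exact h.2 i j hij _ (Finset.min'_mem _ _) _ (Finset.min'_mem _ _)
  · exact Finset.min'_le _ _ ha
  · exact fun i hij => h.2 j i hij _ ha _ (Finset.min'_mem _ _)

theorem le_of_mem_support (h : SuccBlocks γ) {j a : ℕ} (ha : a ∈ (γ j).support) : j ≤ a := by
  obtain ⟨p, hp, hpa⟩ := h.exists_strictMono
  exact (hp.id_le j).trans (hpa j a ha).1

theorem isCBasic (h : SuccBlocks γ) {C : ℝ} {x : ℕ → X} (hx : IsCBasic C x) :
    IsCBasic C fun i => Finsupp.linearCombination ℝ x (γ i) := by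
  refine ⟨fun i => hx.linearCombination_ne_zero (h.1 i), fun n m hnm a => ?_⟩
  obtain ⟨p, hp, hpa⟩ := h.exists_strictMono
  have key : ∀ k, ∑ i ∈ Finset.range k, a i • Finsupp.linearCombination ℝ x (γ i) =
      Finsupp.linearCombination ℝ x (∑ i ∈ Finset.range k, a i • γ i) := by
    intro k
    simp
  rw [key, key]
  have hf : (∑ i ∈ Finset.range m, a i • γ i).filter (· < p n) =
      ∑ i ∈ Finset.range n, a i • γ i := by
    ext l
    rw [Finsupp.filter_apply, Finsupp.finsetSum_apply, Finsupp.finsetSum_apply]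
    split_ifs with hl
    · symm
      apply Finset.sum_subset (Finset.range_mono hnm.le)
      intro i _ hi
      by_contra h0
      have : l ∈ (γ i).support := by
        rw [Finsupp.mem_support_iff]
        rintro h1
        simp [h1] at h0
      have h2 := (hpa i l this).1
      have h3 := hp.monotone (show n ≤ i by simpa using hi)
      omega
    · symm
      apply Finset.sum_eq_zero
      intro i hi
      by_contra h0
      have : l ∈ (γ i).support := by
        rw [Finsupp.mem_support_iff]
        rintro h1
        simp [h1] at h0
      exact hl ((hpa i l this).2 n (by simpa using hi))
  rw [← hf]
  exact hx.norm_filter_lt_le _ _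

theorem isBlockBasisOf (h : SuccBlocks γ) {C : ℝ} {x : ℕ → X} (hx : IsCBasic C x) :
    IsBlockBasisOf x fun i => Finsupp.linearCombination ℝ x (γ i) := by
  obtain ⟨p, hp, hpa⟩ := h.exists_strictMono
  refine ⟨p, fun l => ∑ j ∈ Finset.range (l + 1), γ j l, hp,
    fun i => hx.linearCombination_ne_zero (h.1 i), fun j => ?_⟩
  have hsub : (γ j).support ⊆ Finset.Ico (p j) (p (j + 1)) := fun a ha =>
    Finset.mem_Ico.2 ⟨(hpa j a ha).1, (hpa j a ha).2 _ (Nat.lt_succ_self j)⟩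
  beta_reduce
  rw [Finsupp.linearCombination_apply, Finsupp.sum_of_support_subset _ hsub _ (by simp)]
  refine Finset.sum_congr rfl fun l hl => ?_
  rw [Finset.mem_Ico] at hl
  congr 1
  symm
  apply Finset.sum_eq_single_of_mem
  · have := hp.id_le j
    simp only [Finset.mem_range]
    simp only [id] at this
    omega
  · intro i _ hij
    by_contra h0
    have h1 := hpa i l (Finsupp.mem_support_iff.2 h0)
    rcases lt_or_gt_of_ne hij with h2 | h2
    · have := h1.2 j h2
      omega
    · have := hp.monotone (show j + 1 ≤ i from h2)
      omega

end SuccBlocks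

theorem IsBlockBasisOf.exists_succBlocks {x y : ℕ → X} (h : IsBlockBasisOf x y) :
    ∃ γ, SuccBlocks γ ∧ ∀ i, y i = Finsupp.linearCombination ℝ x (γ i) := by
  obtain ⟨p, b, hp, hne, hy⟩ := h
  have hlc : ∀ j, y j = Finsupp.linearCombination ℝ x
      (∑ l ∈ Finset.Ico (p j) (p (j + 1)), Finsupp.single l (b l)) := by
    intro j
    rw [hy]
    simp
  have hs : ∀ j, ∀ a ∈ (∑ l ∈ Finset.Ico (p j) (p (j + 1)), Finsupp.single l (b l)).support,
      p j ≤ a ∧ a < p (j + 1) := by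
    intro j a ha
    rw [Finsupp.mem_support_iff, Finsupp.finsetSum_apply] at ha
    by_contra h0
    apply ha
    apply Finset.sum_eq_zero
    intro l hl
    rw [Finset.mem_Ico] at hl
    rw [Finsupp.single_apply, if_neg]
    rintro rfl
    exact h0 hl
  refine ⟨_, ⟨fun j h0 => ?_, fun i j hij a ha c hc => ?_⟩, hlc⟩
  · apply hne j
    rw [hlc, h0, map_zero]
  · have h1 := hs i a ha
    have h2 := hs j c hc
    have h3 := hp.monotone (show i + 1 ≤ j from hij)
    omega

theorem IsBlockBasisOf.isBlockBasisUpTo {x y : ℕ → X} (h : IsBlockBasisOf x y) (m : ℕ) :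
    IsBlockBasisUpTo m x y := by
  obtain ⟨p, b, hp, hne, hy⟩ := h
  exact ⟨p, b, hp, fun j _ => hne j, fun j _ => hy j⟩

theorem IsCBasic.isCBasicUpTo {C : ℝ} {x : ℕ → X} (h : IsCBasic C x) (m : ℕ) :
    IsCBasicUpTo C m x :=
  ⟨fun j _ => h.1 j, fun n k hnk _ a => h.2 n k hnk a⟩

end Blocks

/-! ### Iterated limits as trees of partial limits -/

section IteratedLimits

theorem IteratedLimit.exists_tree : ∀ {n : ℕ} {F : (Fin n → ℕ) → ℝ} {L : ℝ},
    IteratedLimit n F L → ∃ H : ℕ → (ℕ → ℕ) → ℝ, (∀ t, H 0 t = L) ∧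
      (∀ t, H n t = F fun j => t j) ∧
      ∀ k < n, ∀ t, Tendsto (fun s => H (k + 1) (Function.update t k s)) atTop (𝓝 (H k t))
  | 0, F, L, h => by
    refine ⟨fun _ _ => L, fun _ => rfl, fun t => ?_, fun k hk => absurd hk (Nat.not_lt_zero k)⟩
    change L = _
    rw [← show F (fun i => i.elim0) = L from h]
    exact congrArg F (funext fun i => i.elim0)
  | n + 1, F, L, h => by
    obtain ⟨g, hg, hgL⟩ := h
    choose H h0 hn hlim using fun i₀ => IteratedLimit.exists_tree (hg i₀)
    refine ⟨fun k t => Nat.casesOn k L fun k => H (t 0) k fun j => t (j + 1), fun _ => rfl,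
      fun t => ?_, fun k hk t => ?_⟩
    · change H (t 0) n (fun j => t (j + 1)) = _
      rw [hn]
      congr 1
      funext j
      refine Fin.cases ?_ (fun j => ?_) j <;> simp
    · cases k with
      | zero =>
        simpa [h0] using hgL
      | succ k =>
        have := hlim (t 0) k (by omega) fun j => t (j + 1)
        refine this.congr fun s => ?_
        have h1 : (fun j => Function.update t (k + 1) s (j + 1)) =
            Function.update (fun j => t (j + 1)) k s := by
          funext j
          simp [Function.update_apply]
        simp [h1]

theorem iteratedLimit_of_tree_from {N : ℕ} {H : ℕ → (ℕ → ℕ) → ℝ}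
    (hdep : ∀ t t', (∀ j < N, t j = t' j) → H N t = H N t')
    (hlim : ∀ k < N, ∀ t,
      Tendsto (fun s => H (k + 1) (Function.update t k s)) atTop (𝓝 (H k t))) :
    ∀ (n k : ℕ) (t : ℕ → ℕ), k + n = N →
    IteratedLimit n (fun s : Fin n → ℕ => H N fun j =>
      if j < k then t j else if h : j - k < n then s ⟨j - k, h⟩ else 0) (H k t)
  | 0, k, t, hN => by
    change H N _ = H k t
    obtain rfl : k = N := by omega
    refine hdep _ _ fun j hj => ?_
    simp [hj]
  | n + 1, k, t, hN => by
    refine ⟨fun i₀ => H (k + 1) (Function.update t k i₀), fun i₀ => ?_,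
      hlim k (by omega) t⟩
    have ih := iteratedLimit_of_tree_from hdep hlim n (k + 1) (Function.update t k i₀) (by omega)
    convert ih using 2 with s
    refine hdep _ _ fun j hj => ?_
    rcases lt_trichotomy j k with h | h | h
    · simp [h, h.ne, Nat.lt_succ_of_lt h]
    · subst h
      simp
    · have h1 : j - k = (j - (k + 1)) + 1 := by omega
      have h2 : j - (k + 1) < n := by omega
      have h3 : j - k < n + 1 := by omega
      rw [if_neg (by omega), dif_pos h3, if_neg (by omega), dif_pos h2]
      have : (⟨j - k, h3⟩ : Fin (n + 1)) = Fin.succ ⟨j - (k + 1), h2⟩ := by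
        ext
        simp [h1]
      rw [this, Fin.cons_succ]

theorem iteratedLimit_of_tree {n : ℕ} {H : ℕ → (ℕ → ℕ) → ℝ}
    (hlim : ∀ k < n, ∀ t,
      Tendsto (fun s => H (k + 1) (Function.update t k s)) atTop (𝓝 (H k t)))
    {F : (Fin n → ℕ) → ℝ} (hF : ∀ t : ℕ → ℕ, H n t = F fun j => t j) :
    IteratedLimit n F (H 0 fun _ => 0) := by
  have hdep : ∀ t t' : ℕ → ℕ, (∀ j < n, t j = t' j) → H n t = H n t' := by
    intro t t' h
    rw [hF, hF]
    exact congrArg F (funext fun j => h j j.2)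
  have h := iteratedLimit_of_tree_from hdep hlim n 0 (fun _ => 0) (Nat.zero_add n)
  convert h using 2 with s
  rw [hF]
  congr 1
  funext j
  simp

end IteratedLimits

/-! ### Partial iterated limits of an array generating an asymptotic model -/

section PartialLimits

/-- `G n c k t` is the value of the norm of `∑ j < n, c j • y j (t j)` after passing to the
iterated limit in the indices `t k, …, t (n - 1)`. -/
structure IsPartialLimit (y : ℕ → ℕ → X) (e : ℕ → E)
    (G : ℕ → (ℕ → ℝ) → ℕ → (ℕ → ℕ) → ℝ) : Prop where
  zero : ∀ n c t, G n c 0 t = ‖∑ j ∈ Finset.range n, c j • e j‖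
  self : ∀ n c t, G n c n t = ‖∑ j ∈ Finset.range n, c j • y j (t j)‖
  tendsto : ∀ n c, ∀ k < n, ∀ t,
    Tendsto (fun s => G n c (k + 1) (Function.update t k s)) atTop (𝓝 (G n c k t))

theorem GeneratesAsymptoticModel.exists_isPartialLimit {y : ℕ → ℕ → X} {e : ℕ → E}
    (h : GeneratesAsymptoticModel y e) : ∃ G, IsPartialLimit y e G := by
  choose G h0 hn hlim using fun n c => (h n c).exists_tree
  refine ⟨G, h0, fun n c t => ?_, hlim⟩
  rw [hn, Finset.sum_range]

namespace IsPartialLimit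

variable {y : ℕ → ℕ → X} {e : ℕ → E} {G : ℕ → (ℕ → ℝ) → ℕ → (ℕ → ℕ) → ℝ}

theorem congr_prefix (hG : IsPartialLimit y e G) {n : ℕ} (c : ℕ → ℝ) {k : ℕ} (hk : k ≤ n) :
    ∀ {t t' : ℕ → ℕ}, (∀ j < k, t j = t' j) → G n c k t = G n c k t' := by
  induction hk using Nat.decreasingInduction with
  | self =>
    intro t t' h
    rw [hG.self, hG.self]
    congr 1
    exact Finset.sum_congr rfl fun j hj => by rw [h j (Finset.mem_range.1 hj)]
  | of_succ k hk ih =>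
    intro t t' h
    refine tendsto_nhds_unique (hG.tendsto n c k hk t)
      ((hG.tendsto n c k hk t').congr fun s => ih fun j hj => ?_)
    rcases Nat.lt_succ_iff_lt_or_eq.1 hj with h1 | h1
    · simp [h1.ne, h j h1]
    · simp [h1]

theorem abs_sub_le (hG : IsPartialLimit y e G) (hy : ∀ l k, ‖y l k‖ = 1) {n : ℕ}
    (c c' : ℕ → ℝ) {k : ℕ} (hk : k ≤ n) :
    ∀ t, |G n c k t - G n c' k t| ≤ ∑ j ∈ Finset.range n, |c j - c' j| := by
  induction hk using Nat.decreasingInduction with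
  | self =>
    intro t
    rw [hG.self, hG.self]
    refine (abs_norm_sub_norm_le _ _).trans ?_
    rw [← Finset.sum_sub_distrib]
    refine (norm_sum_le _ _).trans (Finset.sum_le_sum fun j _ => ?_)
    rw [← sub_smul, norm_smul, hy, mul_one, Real.norm_eq_abs]
  | of_succ k hk ih =>
    intro t
    exact le_of_tendsto ((hG.tendsto n c k hk t).sub (hG.tendsto n c' k hk t)).abs
      (Eventually.of_forall fun s => ih _)

end IsPartialLimit

theorem exists_strictMono_of_eventually {P : ℕ → ℕ → ℕ → Prop}
    (h : ∀ v M, ∀ᶠ t in atTop, P v M t) :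
    ∃ T : ℕ → ℕ, StrictMono T ∧ ∀ v, ∃ M, (∀ v' < v, T v' ≤ M) ∧ P v M (T v) := by
  have h' : ∀ v M, ∃ t, M < t ∧ P v M t := fun v M =>
    ((eventually_gt_atTop M).and (h v M)).exists
  choose N hlt hP using h'
  let T : ℕ → ℕ := fun v => Nat.rec (N 0 0) (fun v t => N (v + 1) t) v
  have hT : StrictMono T := strictMono_nat_of_lt_succ fun v => hlt (v + 1) (T v)
  refine ⟨T, hT, fun v => ?_⟩
  cases v with
  | zero => exact ⟨0, fun v' hv' => absurd hv' (Nat.not_lt_zero _), hP 0 0⟩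
  | succ v =>
    exact ⟨T v, fun v' hv' => hT.monotone (Nat.lt_succ_iff.1 hv'), hP (v + 1) (T v)⟩

theorem IsPartialLimit.eventually_forall_prefix {y : ℕ → ℕ → X} {e : ℕ → E}
    {G : ℕ → (ℕ → ℝ) → ℕ → (ℕ → ℕ) → ℝ} (hG : IsPartialLimit y e G) {n : ℕ} (c : ℕ → ℝ)
    {k : ℕ} (hk : k < n) (M : ℕ) {ε : ℝ} (hε : 0 < ε) :
    ∀ᶠ s in atTop, ∀ t : ℕ → ℕ, (∀ j < k, t j ≤ M) →
      |G n c (k + 1) (Function.update t k s) - G n c k t| ≤ ε := by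
  let pre : (Fin k → Fin (M + 1)) → ℕ → ℕ := fun f j => if h : j < k then f ⟨j, h⟩ else 0
  have h1 : ∀ᶠ s in atTop, ∀ f : Fin k → Fin (M + 1),
      |G n c (k + 1) (Function.update (pre f) k s) - G n c k (pre f)| < ε := by
    rw [eventually_all]
    intro f
    have := (hG.tendsto n c k hk (pre f)).eventually (Metric.ball_mem_nhds _ hε)
    simpa [Real.dist_eq] using this
  filter_upwards [h1] with s hs t ht
  have h2 := hs fun j => ⟨t j, Nat.lt_succ_of_le (ht j j.2)⟩
  set f : Fin k → Fin (M + 1) := fun j => ⟨t j, Nat.lt_succ_of_le (ht j j.2)⟩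
  have h3 : ∀ j < k, pre f j = t j := fun j hj => by simp [pre, f, hj]
  rw [hG.congr_prefix c hk.le h3, hG.congr_prefix c hk (t' := Function.update t k s)] at h2
  · exact h2.le
  · intro j hj
    rcases Nat.lt_succ_iff_lt_or_eq.1 hj with h4 | h4
    · simp [h4.ne, h3 j h4]
    · simp [h4]

theorem exists_finsupp_rat_near (n : ℕ) (c : ℕ → ℝ) {ε : ℝ} (hε : 0 < ε) :
    ∃ q : ℕ →₀ ℚ, ∑ j ∈ Finset.range n, |c j - q j| ≤ ε := by
  have hpos : 0 < ε / (n + 1) := by positivity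
  have h : ∀ j, ∃ r : ℚ, |c j - r| < ε / (n + 1) := fun j => exists_rat_near (c j) hpos
  choose r hr using h
  refine ⟨∑ i ∈ Finset.range n, Finsupp.single i (r i), ?_⟩
  have h2 : ∀ j ∈ Finset.range n, |c j - ((∑ i ∈ Finset.range n, Finsupp.single i (r i)) j : ℚ)|
      ≤ ε / (n + 1) := by
    intro j hj
    have : (∑ i ∈ Finset.range n, Finsupp.single i (r i)) j = r j := by
      simp only [Finsupp.finsetSum_apply, Finsupp.single_apply]
      rw [Finset.sum_ite_eq' (Finset.range n) j, if_pos hj]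
    rw [this]
    exact (hr j).le
  refine (Finset.sum_le_sum h2).trans ?_
  rw [Finset.sum_const, Finset.card_range, nsmul_eq_mul, mul_div_assoc', div_le_iff₀ (by positivity)]
  nlinarith

/-- One can pass to a subsequence, common to all rows, along which consecutive partial limits
are close to each other, uniformly in the preceding indices. -/
theorem IsPartialLimit.exists_rapid {y : ℕ → ℕ → X} {e : ℕ → E}
    {G : ℕ → (ℕ → ℝ) → ℕ → (ℕ → ℕ) → ℝ} (hG : IsPartialLimit y e G)
    (hy : ∀ l k, ‖y l k‖ = 1) (hi : ℕ → ℕ → ℕ) :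
    ∃ T : ℕ → ℕ, StrictMono T ∧ (∀ l v v', v < v' → l ≤ v' → hi l (T v) ≤ T v') ∧
      ∀ n c, ∀ ε > 0, ∃ V, ∀ k l, k ≤ l → l ≤ n → ∀ w : ℕ → ℕ,
        (∀ i j, i < j → k ≤ j → j < l → w i < w j) → (∀ j, k ≤ j → j < l → V ≤ w j) →
        |G n c l (fun i => T (w i)) - G n c k (fun i => T (w i))| ≤ ε := by
  obtain ⟨enum, henum⟩ := exists_surjective_nat (ℕ × (ℕ →₀ ℚ))
  obtain ⟨T, hT, hP⟩ := exists_strictMono_of_eventually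
    (P := fun v M t => (∀ l ∈ Finset.range (v + 1), ∀ t' ∈ Finset.range (M + 1), hi l t' ≤ t) ∧
      ∀ r ∈ Finset.range (v + 1), ∀ k ∈ Finset.range (enum r).1, ∀ w : ℕ → ℕ,
        (∀ j < k, w j ≤ M) →
        |G (enum r).1 (fun j => (enum r).2 j) (k + 1) (Function.update w k t) -
          G (enum r).1 (fun j => (enum r).2 j) k w| ≤ (1 / 2) ^ v) (by
      intro v M
      refine Eventually.and ?_ ?_
      · rw [Filter.eventually_all_finset]
        intro l _
        rw [Filter.eventually_all_finset]
        intro t' _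
        exact eventually_ge_atTop _
      · rw [Filter.eventually_all_finset]
        intro r _
        rw [Filter.eventually_all_finset]
        intro k hk
        exact hG.eventually_forall_prefix _ (Finset.mem_range.1 hk) M (by positivity))
  refine ⟨T, hT, fun l v v' hv hl => ?_, fun n c ε hε => ?_⟩
  · obtain ⟨M, hM, h1, -⟩ := hP v'
    exact h1 l (by simpa [Nat.lt_succ_iff] using hl) _
      (by simpa [Nat.lt_succ_iff] using hM v hv)
  · obtain ⟨q, hq⟩ := exists_finsupp_rat_near n c (show 0 < ε / 4 by positivity)
    obtain ⟨r, hr⟩ := henum (n, q)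
    have hlim : Tendsto (fun V : ℕ => (n : ℝ) * (1 / 2) ^ V) atTop (𝓝 0) := by
      simpa using (tendsto_pow_atTop_nhds_zero_of_lt_one (r := (1 / 2 : ℝ)) (by norm_num)
        (by norm_num)).const_mul (n : ℝ)
    obtain ⟨V, hV, hVr⟩ := ((hlim.eventually (gt_mem_nhds (show 0 < ε / 2 by positivity))).and
      (eventually_ge_atTop r)).exists
    refine ⟨V, fun k l hkl hln w hw hwV => ?_⟩
    have hstep : |G n (fun j => q j) l (fun i => T (w i)) -
        G n (fun j => q j) k (fun i => T (w i))| ≤ (l - k : ℕ) * (1 / 2) ^ V := by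
      induction l, hkl using Nat.le_induction with
      | base => simp
      | succ l hkl ih =>
        have ih' := ih (by omega) (fun i j h1 h2 h3 => hw i j h1 h2 (by omega))
          (fun j h1 h2 => hwV j h1 (by omega))
        have hVl := hwV l hkl (Nat.lt_succ_self l)
        obtain ⟨M, hM, -, h2⟩ := hP (w l)
        have h3 := h2 r (by simp; omega) l (by simpa [hr] using hln) (fun i => T (w i))
          (fun j hj => hM _ (hw j l hj hkl (Nat.lt_succ_self l)))
        rw [hr, show Function.update (fun i => T (w i)) l (T (w l)) = fun i => T (w i) from
          Function.update_eq_self _ _] at h3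
        have h4 : ((1 : ℝ) / 2) ^ w l ≤ (1 / 2) ^ V :=
          pow_le_pow_of_le_one (by norm_num) (by norm_num) hVl
        have h5 : ((l + 1 - k : ℕ) : ℝ) = (l - k : ℕ) + 1 := by
          rw [Nat.sub_add_comm hkl]
          push_cast
          ring
        rw [h5, add_mul, one_mul]
        have h6 := _root_.abs_sub_le (G n (fun j => q j) (l + 1) (fun i => T (w i)))
          (G n (fun j => q j) l (fun i => T (w i))) (G n (fun j => q j) k (fun i => T (w i)))
        dsimp only at h3
        linarith
    have h1 : ((l - k : ℕ) : ℝ) * (1 / 2) ^ V ≤ n * (1 / 2) ^ V := by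
      gcongr
      omega
    have h2 := (hG.abs_sub_le hy c (fun j => q j) hln fun i => T (w i)).trans hq
    have h3 := (hG.abs_sub_le hy c (fun j => q j) (hkl.trans hln) fun i => T (w i)).trans hq
    rw [abs_le] at h2 h3 hstep ⊢
    constructor <;> linarith [h2.1, h2.2, h3.1, h3.2, hstep.1, hstep.2]

end PartialLimits

/-! ### Block bases of asymptotic models are asymptotic models -/

section BlocksOfModels

theorem IsBlockBasisOf.exists_blocks_from_zero {x y : ℕ → X} (h : IsBlockBasisOf x y) :
    ∃ (p : ℕ → ℕ) (a : ℕ → ℝ), StrictMono p ∧ p 0 = 0 ∧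
      ∀ j, y j = ∑ l ∈ Finset.Ico (p j) (p (j + 1)), a l • x l := by
  obtain ⟨p, a, hp, -, hy⟩ := h
  refine ⟨fun j => if j = 0 then 0 else p j, fun l => if l < p 0 then 0 else a l, ?_, by simp,
    fun j => ?_⟩
  · refine strictMono_nat_of_lt_succ fun j => ?_
    have h1 := hp (Nat.lt_succ_self j)
    rcases Nat.eq_zero_or_pos j with h | h
    · subst h
      simpa using Nat.zero_lt_of_lt h1
    · simpa [h.ne'] using h1
  · rw [hy]
    have h1 := hp (Nat.lt_succ_self j)
    have hsub : Finset.Ico (p j) (p (j + 1)) ⊆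
        Finset.Ico (if j = 0 then 0 else p j) (if j + 1 = 0 then 0 else p (j + 1)) := by
      refine Finset.Ico_subset_Ico ?_ (by simp)
      split_ifs <;> simp
    rw [← Finset.sum_subset hsub]
    · refine Finset.sum_congr rfl fun l hl => ?_
      beta_reduce
      rw [if_neg]
      have := hp.monotone (Nat.zero_le j)
      simp only [Finset.mem_Ico] at hl
      omega
    · intro l hl hl'
      beta_reduce
      rw [if_pos, zero_smul]
      simp only [Finset.mem_Ico] at hl hl'
      rcases Nat.eq_zero_or_pos j with h | h
      · subst h
        simp at hl hl'
        omega
      · simp only [h.ne', if_false] at hl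
        simp at hl
        omega

theorem sum_range_eq_sum_blocks {M : Type*} [AddCommMonoid M] {p : ℕ → ℕ} (hp : Monotone p)
    (hp0 : p 0 = 0) (g : ℕ → M) (N : ℕ) :
    ∑ l ∈ Finset.range (p N), g l =
      ∑ j ∈ Finset.range N, ∑ l ∈ Finset.Ico (p j) (p (j + 1)), g l := by
  induction N with
  | zero => simp [hp0]
  | succ N ih =>
    rw [Finset.sum_range_succ, ← ih, Finset.sum_range_add_sum_Ico _ (hp (Nat.le_succ N))]

theorem sum_range_ite_smul {m n : ℕ} (hmn : m ≤ n) (a : ℕ → ℝ) (x : ℕ → X) :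
    ∑ l ∈ Finset.range n, (if m ≤ l then a l else 0) • x l =
      ∑ l ∈ Finset.Ico m n, a l • x l := by
  rw [← Finset.sum_range_add_sum_Ico _ hmn, Finset.sum_eq_zero, zero_add]
  · refine Finset.sum_congr rfl fun l hl => ?_
    rw [if_pos (Finset.mem_Ico.1 hl).1]
  · intro l hl
    have : ¬ m ≤ l := by simpa using hl
    rw [if_neg this, zero_smul]

theorem exists_block_index {p : ℕ → ℕ} (hp : StrictMono p) (hp0 : p 0 = 0) :
    ∃ J : ℕ → ℕ, (∀ l, p (J l) ≤ l) ∧ ∀ j l, p j ≤ l → l < p (j + 1) → J l = j := by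
  have hspec : ∀ l, p (Nat.findGreatest (fun j => p j ≤ l) l) ≤ l := fun l =>
    Nat.findGreatest_spec (P := fun j => p j ≤ l) (Nat.zero_le l) (by rw [hp0]; exact Nat.zero_le l)
  refine ⟨fun l => Nat.findGreatest (fun j => p j ≤ l) l, hspec, fun j l h1 h2 => ?_⟩
  have h3 : j ≤ l := (hp.id_le j).trans h1
  refine le_antisymm ?_ (Nat.le_findGreatest h3 h1)
  by_contra h4
  push Not at h4
  have h5 := hspec l
  have h6 := hp.monotone (show j + 1 ≤ Nat.findGreatest (fun j => p j ≤ l) l from h4)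
  omega

theorem isBlockGenerated_of_isBlockBasisOf {b : ℕ → X} {C : ℝ} (hb : IsCBasic C b)
    {e : ℕ → E} (he : IsBlockGeneratedAsymptoticModel b e) {f : ℕ → E} (hf : Normalized f)
    (hfe : IsBlockBasisOf e f) : IsBlockGeneratedAsymptoticModel b f := by
  obtain ⟨-, ⟨Ce, hCe⟩, y, ⟨⟨K, hK⟩, hyrow, -⟩, hgen⟩ := he
  have hfC : IsCBasic Ce f := by
    obtain ⟨γ, hγ, hfγ⟩ := hfe.exists_succBlocks
    rw [show f = fun i => Finsupp.linearCombination ℝ e (γ i) from funext hfγ]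
    exact hγ.isCBasic hCe
  refine ⟨hf, ⟨Ce, hfC⟩, ?_⟩
  have hynorm : ∀ l k, ‖y l k‖ = 1 := fun l k => (hK.1 l).1 k
  obtain ⟨p, a, hp, hp0, hfp⟩ := hfe.exists_blocks_from_zero
  obtain ⟨J, hpJ, hJ⟩ := exists_block_index hp hp0
  choose β hβ hyβ using fun l => (hyrow l).exists_succBlocks
  choose hi hhi using fun l k => exists_support_lt (β l k)
  obtain ⟨G, hG⟩ := hgen.exists_isPartialLimit
  obtain ⟨T, hT, hThi, hTG⟩ := hG.exists_rapid hynorm hi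
  -- rows up to `s` are realized at level `s` inside the window `[T (u s), T (u (s + 1)))`
  let u : ℕ → ℕ := fun s => ∑ r ∈ Finset.range s, p (r + 1)
  have hu_succ : ∀ s, u (s + 1) = u s + p (s + 1) := fun s => Finset.sum_range_succ _ _
  have hu : StrictMono u := strictMono_nat_of_lt_succ fun s => by
    rw [hu_succ]
    have := hp (Nat.succ_pos s)
    simp only [Nat.succ_eq_add_one] at this
    omega
  let ω : ℕ → ℕ → ℕ →₀ ℝ := fun j s =>
    ∑ l ∈ Finset.Ico (p j) (p (j + 1)), a l • β l (T (u s + l))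
  let w : ℕ → ℕ → X := fun j s =>
    ∑ l ∈ Finset.Ico (p j) (p (j + 1)), a l • y l (T (u s + l))
  have hw : ∀ j s, w j s = Finsupp.linearCombination ℝ b (ω j s) := by
    intro j s
    simp [w, ω, hyβ]
  have hβsupp : ∀ l v x, x ∈ (β l (T v)).support → T v ≤ x ∧ ∀ v', v < v' → l ≤ v' → x < T v' :=
    fun l v x hx => ⟨(hβ l).le_of_mem_support hx,
      fun v' h1 h2 => (hhi l (T v) x hx).trans_le (hThi l v v' h1 h2)⟩
  have hdiag : ∀ v, SuccBlocks fun l => β l (T (v + l)) := by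
    intro v
    refine ⟨fun l => (hβ l).1 _, fun i j hij x hx x' hx' => ?_⟩
    exact ((hβsupp i (v + i) x hx).2 (v + j) (by omega) (by omega)).trans_le
      (hβsupp j (v + j) x' hx').1
  have hane : ∀ j, ∃ l ∈ Finset.Ico (p j) (p (j + 1)), a l ≠ 0 := by
    intro j
    by_contra h
    push Not at h
    have h1 := hf j
    rw [hfp, Finset.sum_eq_zero fun l hl => by rw [h l hl, zero_smul], norm_zero] at h1
    exact zero_ne_one h1
  have hwne : ∀ j s, w j s ≠ 0 := by
    intro j s
    have h1 := (hdiag (u s)).isCBasic hb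
    have h2 : w j s = Finsupp.linearCombination ℝ
        (fun l => Finsupp.linearCombination ℝ b (β l (T (u s + l))))
        (∑ l ∈ Finset.Ico (p j) (p (j + 1)), Finsupp.single l (a l)) := by
      simp [w, hyβ]
    rw [h2]
    refine h1.linearCombination_ne_zero fun h0 => ?_
    obtain ⟨l, hl, hal⟩ := hane j
    apply hal
    have h3 := DFunLike.congr_fun h0 l
    simp only [Finsupp.finsetSum_apply, Finsupp.single_apply] at h3
    rw [Finset.sum_ite_eq' _ l, if_pos hl] at h3
    simpa using h3
  have hωsupp : ∀ j s, j ≤ s → ∀ x ∈ (ω j s).support, T (u s) ≤ x ∧ x < T (u (s + 1)) := by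
    intro j s hjs x hx
    obtain ⟨l, hl, hxl⟩ := Finset.mem_biUnion.1 (Finsupp.support_finsetSum hx)
    have hxl := Finsupp.support_smul hxl
    rw [Finset.mem_Ico] at hl
    have h1 := hβsupp l _ x hxl
    have h2 := hp.monotone (show j + 1 ≤ s + 1 by omega)
    refine ⟨(hT.monotone (Nat.le_add_right _ _)).trans h1.1, h1.2 _ ?_ ?_⟩
    · rw [hu_succ]
      omega
    · rw [hu_succ]
      omega
  have hωblocks : ∀ ρ s : ℕ → ℕ, StrictMono s → (∀ r, ρ r ≤ s r) →
      SuccBlocks fun r => ω (ρ r) (s r) := by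
    intro ρ s hs hρ
    refine ⟨fun r h0 => hwne (ρ r) (s r) ?_, fun i j hij x hx x' hx' => ?_⟩
    · rw [hw]
      exact (congrArg _ h0).trans (map_zero _)
    · refine ((hωsupp _ _ (hρ i) x hx).2.trans_le ?_).trans_le (hωsupp _ _ (hρ j) x' hx').1
      exact hT.monotone (hu.monotone (hs hij))
  let z : ℕ → ℕ → X := fun j i => ‖w j (i + j)‖⁻¹ • w j (i + j)
  have hz : ∀ ρ i : ℕ → ℕ, (StrictMono fun r => i r + ρ r) →
      IsCBasic C (fun r => z (ρ r) (i r)) ∧ IsBlockBasisOf b fun r => z (ρ r) (i r) := by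
    intro ρ i hs
    have h1 := (hωblocks ρ _ hs fun r => Nat.le_add_left _ _).smul
      (s := fun r => ‖w (ρ r) (i r + ρ r)‖⁻¹) fun r => inv_ne_zero (norm_ne_zero_iff.2 (hwne _ _))
    have h2 : (fun r => z (ρ r) (i r)) = fun r => Finsupp.linearCombination ℝ b
        (‖w (ρ r) (i r + ρ r)‖⁻¹ • ω (ρ r) (i r + ρ r)) := by
      funext r
      rw [map_smul, ← hw]
    rw [h2]
    exact ⟨h1.isCBasic hb, h1.isBlockBasisOf hb⟩
  have hzrow : ∀ n, IsCBasic C (z n) ∧ IsBlockBasisOf b (z n) := fun n =>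
    hz (fun _ => n) (fun r => r) fun _ _ h => Nat.add_lt_add_right h n
  have hzdiag : ∀ i : ℕ → ℕ, StrictMono i →
      IsCBasic C (fun j => z j (i j)) ∧ IsBlockBasisOf b fun j => z j (i j) := fun i hmono =>
    hz (fun r => r) i fun _ _ h => Nat.add_lt_add (hmono h) h
  refine ⟨z, ⟨⟨C, fun n => ⟨fun i => ?_, (hzrow n).1⟩, fun m i h _ =>
    (hzdiag i h).1.isCBasicUpTo m⟩, fun n => (hzrow n).2, fun m i h _ =>
    (hzdiag i h).2.isBlockBasisUpTo m⟩, ?_⟩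
  · rw [norm_smul, norm_inv, norm_norm, inv_mul_cancel₀ (norm_ne_zero_iff.2 (hwne _ _))]
  have hwlim : ∀ j, Tendsto (fun s => ‖w j s‖) atTop (𝓝 1) := by
    intro j
    rw [Metric.tendsto_atTop]
    intro ε hε
    let c : ℕ → ℝ := fun l => if p j ≤ l then a l else 0
    obtain ⟨V, hV⟩ := hTG (p (j + 1)) c (ε / 2) (half_pos hε)
    refine ⟨V, fun s hs => ?_⟩
    have h1 := hV 0 (p (j + 1)) (Nat.zero_le _) le_rfl (fun l => u s + l)
      (fun i j h _ _ => by omega) (fun i _ _ => by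
        have := hu.id_le s
        simp only [id] at this
        omega)
    rw [hG.self, hG.zero] at h1
    have h2 : ∑ l ∈ Finset.range (p (j + 1)), c l • y l (T (u s + l)) = w j s :=
      sum_range_ite_smul (hp.monotone (Nat.le_succ j)) a fun l => y l (T (u s + l))
    have h3 : ∑ l ∈ Finset.range (p (j + 1)), c l • e l = f j := by
      rw [hfp, ← sum_range_ite_smul (hp.monotone (Nat.le_succ j))]
    rw [h2, h3, hf j] at h1
    rw [Real.dist_eq]
    linarith
  intro N d
  have hJlt : ∀ l k, l < p k → J l < k := by
    intro l k hl
    by_contra h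
    have h1 := hp.monotone (not_lt.1 h)
    have h2 := hpJ l
    omega
  let v : (ℕ → ℕ) → ℕ → ℕ := fun t l => u (t (J l) + J l) + l
  let c : ℕ → (ℕ → ℕ) → ℕ → ℝ := fun k t l =>
    d (J l) * a l * if J l < k then ‖w (J l) (t (J l) + J l)‖⁻¹ else 1
  let H : ℕ → (ℕ → ℕ) → ℝ := fun k t => G (p N) (c k t) (p k) fun l => T (v t l)
  have hlim : ∀ k < N, ∀ t,
      Tendsto (fun s => H (k + 1) (Function.update t k s)) atTop (𝓝 (H k t)) := by
    intro k hk t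
    have hkN : p (k + 1) ≤ p N := hp.monotone hk
    have hcoeff : Tendsto (fun s => ∑ l ∈ Finset.range (p N),
        |c (k + 1) (Function.update t k s) l - c k t l|) atTop (𝓝 0) := by
      rw [← Finset.sum_const_zero (s := Finset.range (p N))]
      refine tendsto_finsetSum _ fun l _ => ?_
      rcases lt_trichotomy (J l) k with h | h | h
      · simp [c, h, Nat.lt_succ_of_lt h, h.ne]
      · have h1 : Tendsto (fun s => d k * a l * ‖w k (s + k)‖⁻¹) atTop
            (𝓝 (d k * a l * 1⁻¹)) :=
          (((tendsto_add_atTop_iff_nat k).2 (hwlim k)).inv₀ one_ne_zero).const_mul _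
        have h2 := (h1.sub_const (d k * a l)).abs
        simpa [c, h] using h2
      · simp [c, h.not_gt, (show ¬ J l < k + 1 by omega)]
    rw [Metric.tendsto_atTop']
    intro ε hε
    obtain ⟨V, hV⟩ := hTG (p N) (c k t) (ε / 2) (half_pos hε)
    obtain ⟨S, hS⟩ := eventually_atTop.1 (hcoeff.eventually (gt_mem_nhds (half_pos hε)))
    obtain ⟨B, hB⟩ : ∃ B, ∀ j < k, t j + j ≤ B :=
      ⟨(Finset.range k).sup fun j => t j + j, fun j hj =>
        Finset.le_sup (f := fun j => t j + j) (Finset.mem_range.2 hj)⟩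
    refine ⟨max V (max S B), fun s hs => ?_⟩
    simp only [gt_iff_lt, max_lt_iff] at hs
    have h1 := hG.abs_sub_le hynorm (c (k + 1) (Function.update t k s)) (c k t) hkN
      fun l => T (v (Function.update t k s) l)
    have h2 := hS s hs.2.1.le
    have hJk : ∀ j, p k ≤ j → j < p (k + 1) → J j = k := fun j => hJ k j
    have h3 := hV (p k) (p (k + 1)) (hp.monotone (Nat.le_succ k)) hkN
      (v (Function.update t k s)) (fun i j hij hkj hjk => by
        have hi' := hJlt i (k + 1) (hij.trans hjk)
        have h4 : Function.update t k s (J i) + J i ≤ s + k := by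
          rcases Nat.lt_succ_iff_lt_or_eq.1 hi' with h | h
          · rw [Function.update_of_ne h.ne]
            have := hB _ h
            omega
          · simp [h]
        have h5 := hu.monotone h4
        simp only [v, hJk j hkj hjk, Function.update_self]
        omega) (fun j hkj hjk => by
        simp only [v, hJk j hkj hjk, Function.update_self]
        have := hu.id_le (s + k)
        simp only [id] at this
        omega)
    have h4 : G (p N) (c k t) (p k) (fun l => T (v (Function.update t k s) l)) =
        G (p N) (c k t) (p k) fun l => T (v t l) := by
      refine hG.congr_prefix _ (hp.monotone hk.le) fun l hl => ?_
      simp only [v, Function.update_of_ne (hJlt l k hl).ne]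
    rw [h4] at h3
    rw [Real.dist_eq]
    refine (_root_.abs_sub_le _ (G (p N) (c k t) (p (k + 1))
      fun l => T (v (Function.update t k s) l)) _).trans_lt ?_
    linarith
  have hend : ∀ t : ℕ → ℕ, H N t = ‖∑ j : Fin N, d j • z j (t j)‖ := by
    intro t
    simp only [H]
    rw [hG.self, sum_range_eq_sum_blocks hp.monotone hp0,
      Fin.sum_univ_eq_sum_range fun j => d j • z j (t j)]
    congr 1
    refine Finset.sum_congr rfl fun j hj => ?_
    simp only [z]
    rw [Finset.smul_sum, Finset.smul_sum]
    refine Finset.sum_congr rfl fun l hl => ?_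
    rw [Finset.mem_Ico] at hl
    have hJl := hJ j l hl.1 hl.2
    simp only [c, v, hJl, if_pos (Finset.mem_range.1 hj), smul_smul]
    congr 1
    ring
  have hstart : H 0 (fun _ => 0) = ‖∑ j ∈ Finset.range N, d j • f j‖ := by
    simp only [H]
    rw [hp0, hG.zero, sum_range_eq_sum_blocks hp.monotone hp0]
    congr 1
    refine Finset.sum_congr rfl fun j _ => ?_
    rw [hfp, Finset.smul_sum]
    refine Finset.sum_congr rfl fun l hl => ?_
    rw [Finset.mem_Ico] at hl
    simp [c, hJ j l hl.1 hl.2, smul_smul]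
  rw [← hstart]
  exact iteratedLimit_of_tree hlim hend

end BlocksOfModels

/-! ### Uniform equivalence of a perfectly homogeneous sequence with its block bases -/

section UniformEquivalence

theorem SeqEquiv.exists_const {e : ℕ → E} {f : ℕ → X} (h : SeqEquiv e f) :
    ∃ K : ℝ, 0 < K ∧ ∀ c : ℕ →₀ ℝ,
      ‖Finsupp.linearCombination ℝ f c‖ ≤ K * ‖Finsupp.linearCombination ℝ e c‖ ∧
        ‖Finsupp.linearCombination ℝ e c‖ ≤ K * ‖Finsupp.linearCombination ℝ f c‖ := by
  obtain ⟨A, B, hA, hB, h⟩ := h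
  refine ⟨max A B, lt_max_of_lt_left hA, fun c => ?_⟩
  obtain ⟨n, hn⟩ := exists_support_lt c
  have h1 := h n c
  rw [← linearCombination_eq_sum_range e hn, ← linearCombination_eq_sum_range f hn] at h1
  constructor
  · refine h1.2.trans ?_
    gcongr
    exact le_max_right _ _
  · have h2 := (inv_mul_le_iff₀ hA).1 h1.1
    refine h2.trans ?_
    gcongr
    exact le_max_left _ _

/-- Every normalized block sequence of `e` is equivalent to `e` with the uniform constant `D` in
both directions. -/
def UniformBlockEquiv (D : ℝ) (e : ℕ → E) : Prop :=
  ∀ γ : ℕ → ℕ →₀ ℝ, SuccBlocks γ → (∀ i, ‖Finsupp.linearCombination ℝ e (γ i)‖ = 1) →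
    ∀ c : ℕ →₀ ℝ,
      ‖Finsupp.linearCombination ℝ (fun i => Finsupp.linearCombination ℝ e (γ i)) c‖ ≤
          D * ‖Finsupp.linearCombination ℝ e c‖ ∧
        ‖Finsupp.linearCombination ℝ e c‖ ≤
          D * ‖Finsupp.linearCombination ℝ (fun i => Finsupp.linearCombination ℝ e (γ i)) c‖

theorem exists_const_of_forall_seqEquiv_of_le {e : ℕ → E} (hn : Normalized e)
    (H : ∀ γ : ℕ → ℕ →₀ ℝ, SuccBlocks γ →
      (∀ i, ‖Finsupp.linearCombination ℝ e (γ i)‖ = 1) →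
        SeqEquiv e fun i => Finsupp.linearCombination ℝ e (γ i)) :
    ∃ P K : ℕ, ∀ γ : ℕ → ℕ →₀ ℝ, SuccBlocks γ →
      (∀ i, ‖Finsupp.linearCombination ℝ e (γ i)‖ = 1) →
      ∀ c : ℕ →₀ ℝ, (∀ i ∈ c.support, P ≤ i) →
      ‖Finsupp.linearCombination ℝ (fun i => Finsupp.linearCombination ℝ e (γ i)) c‖ ≤
          K * ‖Finsupp.linearCombination ℝ e c‖ ∧
        ‖Finsupp.linearCombination ℝ e c‖ ≤
          K * ‖Finsupp.linearCombination ℝ (fun i => Finsupp.linearCombination ℝ e (γ i)) c‖ := by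
  by_contra hcon
  have hbad : ∀ P K : ℕ, ∃ (γ : ℕ → ℕ →₀ ℝ) (c : ℕ →₀ ℝ) (Q : ℕ), SuccBlocks γ ∧
      (∀ i, ‖Finsupp.linearCombination ℝ e (γ i)‖ = 1) ∧ P < Q ∧
      (∀ i ∈ c.support, P ≤ i ∧ i < Q ∧ ∀ a ∈ (γ i).support, a < Q) ∧
      ¬ (‖Finsupp.linearCombination ℝ (fun i => Finsupp.linearCombination ℝ e (γ i)) c‖ ≤
          K * ‖Finsupp.linearCombination ℝ e c‖ ∧
        ‖Finsupp.linearCombination ℝ e c‖ ≤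
          K * ‖Finsupp.linearCombination ℝ
            (fun i => Finsupp.linearCombination ℝ e (γ i)) c‖) := by
    intro P K
    by_contra hno
    refine hcon ⟨P, K, fun γ hγ hγ1 c hc => ?_⟩
    by_contra hnot
    refine hno ⟨γ, c, P + c.support.sup id + (c.support.biUnion fun i => (γ i).support).sup id + 1,
      hγ, hγ1, by omega, fun i hi => ⟨hc i hi, ?_, fun a ha => ?_⟩, hnot⟩
    · have := Finset.le_sup (f := id) hi
      simp only [id] at this
      omega
    · have := Finset.le_sup (f := id)
        (Finset.mem_biUnion.2 ⟨i, hi, ha⟩ : a ∈ c.support.biUnion fun i => (γ i).support)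
      simp only [id] at this
      omega
  choose γ' c' Q hγ' hγ1' hQ hc' hbad using hbad
  let P : ℕ → ℕ := fun r => Nat.rec 0 (fun r p => Q p r) r
  have hP : StrictMono P := strictMono_nat_of_lt_succ fun r => hQ (P r) r
  let γ : ℕ → ℕ → ℕ →₀ ℝ := fun r => γ' (P r) r
  let c : ℕ → ℕ →₀ ℝ := fun r => c' (P r) r
  have hc : ∀ r, ∀ i ∈ (c r).support,
      P r ≤ i ∧ i < P (r + 1) ∧ ∀ a ∈ (γ r i).support, a < P (r + 1) := fun r => hc' (P r) r
  let T : ℕ → Prop := fun i => ∃ r, i ∈ (c r).support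
  have hcne : ∀ r, (c r).support.Nonempty := by
    intro r
    rw [Finsupp.support_nonempty_iff]
    intro h0
    refine hbad (P r) r ?_
    change c' (P r) r = 0 at h0
    simp [h0]
  have hT : (Set.ofPred T).Infinite := by
    refine Set.infinite_of_not_bddAbove ?_
    rintro ⟨N, hN⟩
    obtain ⟨i, hi⟩ := hcne (N + 1)
    have h1 := hN (show T i from ⟨N + 1, hi⟩)
    have h2 := (hc (N + 1) i hi).1
    have h3 := hP.id_le (N + 1)
    simp only [id] at h3
    omega
  let φ : ℕ → ℕ := Nat.nth T
  have hφ : StrictMono φ := Nat.nth_strictMono hT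
  have hφT : ∀ k, T (φ k) := fun k => Nat.nth_mem_of_infinite hT k
  choose ρ hρ using hφT
  have huniq : ∀ r s i, i ∈ (c r).support → i ∈ (c s).support → ¬ r < s := by
    intro r s i hr hs hlt
    have h1 := (hc r i hr).2.1
    have h2 := (hc s i hs).1
    have h3 := hP.monotone (Nat.succ_le_of_lt hlt)
    simp only [Nat.succ_eq_add_one] at h3
    omega
  have hz : SuccBlocks fun k => γ (ρ k) (φ k) := by
    refine ⟨fun k => (hγ' _ _).1 _, fun i j hij a ha b hb => ?_⟩
    rcases lt_trichotomy (ρ i) (ρ j) with h | h | h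
    · have h1 := (hc _ _ (hρ i)).2.2 a ha
      have h2 := hP.monotone (Nat.succ_le_of_lt h)
      have h3 := (hc _ _ (hρ j)).1
      have h4 := (hγ' _ _).le_of_mem_support hb
      simp only [Nat.succ_eq_add_one] at h2
      omega
    · simp only [← h] at hb
      exact (hγ' _ _).2 _ _ (hφ hij) a ha b hb
    · have h1 := (hc _ _ (hρ j)).2.1
      have h2 := hP.monotone (Nat.succ_le_of_lt h)
      have h3 := (hc _ _ (hρ i)).1
      have h4 := hφ hij
      simp only [Nat.succ_eq_add_one] at h2
      omega
  have hw : SuccBlocks fun k => Finsupp.single (φ k) (1 : ℝ) := by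
    refine ⟨fun k => by simp, fun i j hij a ha b hb => ?_⟩
    have h1 := Finsupp.support_single_subset ha
    have h2 := Finsupp.support_single_subset hb
    rw [Finset.mem_singleton] at h1 h2
    rw [h1, h2]
    exact hφ hij
  obtain ⟨K, hK, hKz⟩ := (H _ hz fun k => hγ1' _ _ _).exists_const
  obtain ⟨L, hL, hLw⟩ := (H _ hw fun k => by simpa using hn (φ k)).exists_const
  obtain ⟨r, hr⟩ := exists_nat_ge (K * L)
  refine hbad (P r) r ?_
  have hrange : ∀ i ∈ (c r).support, i ∈ Set.range φ := by
    intro i hi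
    rw [Nat.range_nth_of_infinite hT]
    exact ⟨r, hi⟩
  let d : ℕ →₀ ℝ := Finsupp.comapDomain φ (c r) hφ.injective.injOn
  have hd : Finsupp.mapDomain φ d = c r := Finsupp.mapDomain_comapDomain φ hφ.injective (c r) hrange
  have h1 : Finsupp.linearCombination ℝ e (c r) = Finsupp.linearCombination ℝ
      (fun k => Finsupp.linearCombination ℝ e (Finsupp.single (φ k) (1 : ℝ))) d := by
    rw [← hd, Finsupp.linearCombination_mapDomain]
    simp [Function.comp_def]
  have h2 : Finsupp.linearCombination ℝ (fun i => Finsupp.linearCombination ℝ e (γ r i)) (c r) =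
      Finsupp.linearCombination ℝ
        (fun k => Finsupp.linearCombination ℝ e (γ (ρ k) (φ k))) d := by
    rw [← hd, Finsupp.linearCombination_mapDomain, Finsupp.linearCombination_apply,
      Finsupp.linearCombination_apply]
    refine Finsupp.sum_congr fun k hk => ?_
    have hk' : φ k ∈ (c r).support := by
      rw [Finsupp.mem_support_iff] at hk ⊢
      exact hk
    have : ρ k = r := le_antisymm (not_lt.1 (huniq _ _ _ hk' (hρ k)))
      (not_lt.1 (huniq _ _ _ (hρ k) hk'))
    simp [this]
  have hz1 := hKz d
  have hw1 := hLw d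
  rw [← h2] at hz1
  rw [← h1] at hw1
  constructor
  · calc _ ≤ K * ‖Finsupp.linearCombination ℝ e d‖ := hz1.1
      _ ≤ K * (L * ‖Finsupp.linearCombination ℝ e (c r)‖) := by
        gcongr
        exact hw1.2
      _ = K * L * ‖Finsupp.linearCombination ℝ e (c r)‖ := by ring
      _ ≤ r * ‖Finsupp.linearCombination ℝ e (c r)‖ := by gcongr
  · calc _ ≤ L * ‖Finsupp.linearCombination ℝ e d‖ := hw1.1
      _ ≤ L * (K * ‖Finsupp.linearCombination ℝ
            (fun i => Finsupp.linearCombination ℝ e (γ r i)) (c r)‖) := by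
        gcongr
        exact hz1.2
      _ = K * L * ‖Finsupp.linearCombination ℝ
            (fun i => Finsupp.linearCombination ℝ e (γ r i)) (c r)‖ := by ring
      _ ≤ r * ‖Finsupp.linearCombination ℝ
            (fun i => Finsupp.linearCombination ℝ e (γ r i)) (c r)‖ := by gcongr

theorem IsCBasic.norm_le_of_tail {C : ℝ} {x : ℕ → X} {y : ℕ → E} (hy : IsCBasic C y)
    (hxn : Normalized x) (hyn : Normalized y) {P : ℕ} {K : ℝ} (hK : 0 ≤ K)
    (h : ∀ c : ℕ →₀ ℝ, (∀ i ∈ c.support, P ≤ i) →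
      ‖Finsupp.linearCombination ℝ x c‖ ≤ K * ‖Finsupp.linearCombination ℝ y c‖)
    (c : ℕ →₀ ℝ) :
    ‖Finsupp.linearCombination ℝ x c‖ ≤
      (P * (2 * C) + K * (1 + C)) * ‖Finsupp.linearCombination ℝ y c‖ := by
  have h1 : ‖Finsupp.linearCombination ℝ x (c.filter (· < P))‖ ≤
      P * (2 * C * ‖Finsupp.linearCombination ℝ y c‖) := by
    rw [linearCombination_eq_sum_range x (n := P) fun i hi => by
      rw [Finsupp.support_filter, Finset.mem_filter] at hi
      exact hi.2]
    refine (norm_sum_le _ _).trans ?_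
    refine (Finset.sum_le_card_nsmul _ _ (2 * C * ‖Finsupp.linearCombination ℝ y c‖) ?_).trans
      (by simp)
    intro i hi
    have h2 := hy.abs_coeff_le c i
    rw [hyn i, mul_one] at h2
    rw [Finsupp.filter_apply, if_pos (Finset.mem_range.1 hi), norm_smul, hxn i, mul_one]
    exact h2
  have h2 := h (c.filter fun i => ¬ i < P) fun i hi => by
    rw [Finsupp.support_filter, Finset.mem_filter] at hi
    exact not_lt.1 hi.2
  have h3 := hy.norm_filter_ge_le c P
  have h4 : Finsupp.linearCombination ℝ x c =
      Finsupp.linearCombination ℝ x (c.filter (· < P)) +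
        Finsupp.linearCombination ℝ x (c.filter fun i => ¬ i < P) := by
    rw [← map_add, Finsupp.filter_add_filter_not]
  rw [h4]
  refine (norm_add_le _ _).trans ?_
  have h5 := h2.trans (mul_le_mul_of_nonneg_left h3 hK)
  linarith

theorem exists_uniformBlockEquiv {e : ℕ → E} {C : ℝ} (hn : Normalized e) (he : IsCBasic C e)
    (H : ∀ γ : ℕ → ℕ →₀ ℝ, SuccBlocks γ →
      (∀ i, ‖Finsupp.linearCombination ℝ e (γ i)‖ = 1) →
        SeqEquiv e fun i => Finsupp.linearCombination ℝ e (γ i)) :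
    ∃ D : ℝ, 1 ≤ D ∧ UniformBlockEquiv D e := by
  obtain ⟨P, K, h⟩ := exists_const_of_forall_seqEquiv_of_le hn H
  have hC := he.one_le
  refine ⟨max 1 (P * (2 * C) + K * (1 + C)), le_max_left _ _, fun γ hγ hγ1 c => ?_⟩
  constructor
  · refine (he.norm_le_of_tail hγ1 hn (Nat.cast_nonneg K)
      (fun c hc => (h γ hγ hγ1 c hc).1) c).trans ?_
    gcongr
    exact le_max_right _ _
  · refine ((hγ.isCBasic he).norm_le_of_tail hn hγ1 (Nat.cast_nonneg K)
      (fun c hc => (h γ hγ hγ1 c hc).2) c).trans ?_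
    gcongr
    exact le_max_right _ _

end UniformEquivalence

/-! ### Unconditionality and sums over blocks -/

section BlockSums

namespace UniformBlockEquiv

variable {e : ℕ → E} {D : ℝ}

theorem norm_sum_smul_le (h : UniformBlockEquiv D e) {γ : ℕ → ℕ →₀ ℝ} (hγ : SuccBlocks γ)
    (hγ1 : ∀ i, ‖Finsupp.linearCombination ℝ e (γ i)‖ = 1) (n : ℕ) (c : ℕ → ℝ) :
    ‖∑ i ∈ Finset.range n, c i • Finsupp.linearCombination ℝ e (γ i)‖ ≤
        D * ‖∑ i ∈ Finset.range n, c i • e i‖ ∧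
      ‖∑ i ∈ Finset.range n, c i • e i‖ ≤
        D * ‖∑ i ∈ Finset.range n, c i • Finsupp.linearCombination ℝ e (γ i)‖ := by
  have := h γ hγ hγ1 (coeffBelow n c)
  simpa only [linearCombination_coeffBelow] using this

theorem norm_sum_le_of_abs_eq (h : UniformBlockEquiv D e) (he : Normalized e) {n : ℕ}
    {c d : ℕ → ℝ} (hcd : ∀ i < n, |c i| = |d i|) :
    ‖∑ i ∈ Finset.range n, c i • e i‖ ≤ D * ‖∑ i ∈ Finset.range n, d i • e i‖ := by
  let s : ℕ → ℝ := fun i => if c i = d i then 1 else -1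
  have hs : ∀ i, s i = 1 ∨ s i = -1 := fun i => by
    by_cases hi : c i = d i <;> simp [s, hi]
  have hc : ∀ i < n, d i * s i = c i := fun i hin => by
    by_cases hi : c i = d i
    · simp [s, hi]
    · rcases abs_eq_abs.1 (hcd i hin) with h1 | h1
      · exact absurd h1 hi
      · simp only [s, if_neg hi]
        linarith
  have hs0 : ∀ i, s i ≠ 0 := fun i => by rcases hs i with h1 | h1 <;> simp [h1]
  have hγ : SuccBlocks fun i => Finsupp.single i (s i) := by
    refine ⟨fun i => by simp [hs0 i], fun i j hij a ha b hb => ?_⟩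
    have h1 := Finsupp.support_single_subset ha
    have h2 := Finsupp.support_single_subset hb
    rw [Finset.mem_singleton] at h1 h2
    omega
  have h1 := (h.norm_sum_smul_le hγ (fun i => by
    rcases hs i with h1 | h1 <;> simp [h1, he i]) n d).1
  convert h1 using 2
  refine Finset.sum_congr rfl fun i hi => ?_
  rw [Finsupp.linearCombination_single, smul_smul, hc i (Finset.mem_range.1 hi)]

theorem norm_sum_le_of_abs_le (h : UniformBlockEquiv D e) (he : Normalized e) {n : ℕ}
    {c d : ℕ → ℝ} (hcd : ∀ i < n, |c i| ≤ |d i|) :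
    ‖∑ i ∈ Finset.range n, c i • e i‖ ≤ D * ‖∑ i ∈ Finset.range n, d i • e i‖ := by
  have key : ∀ (s : Finset ℕ) (c : ℕ → ℝ), (∀ i < n, |c i| ≤ |d i|) →
      (∀ i < n, i ∉ s → |c i| = |d i|) →
      ‖∑ i ∈ Finset.range n, c i • e i‖ ≤ D * ‖∑ i ∈ Finset.range n, d i • e i‖ := by
    intro s
    induction s using Finset.induction with
    | empty => exact fun c _ hc => h.norm_sum_le_of_abs_eq he fun i hi => hc i hi (by simp)
    | insert a s _ ih =>
      intro c hle hc
      by_cases ha : a < n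
      swap
      · refine ih c hle fun i hi his => hc i hi ?_
        rw [Finset.mem_insert, not_or]
        exact ⟨by omega, his⟩
      have hupd : ∀ t : ℝ, |t| = |d a| →
          ‖∑ i ∈ Finset.range n, Function.update c a t i • e i‖ ≤
            D * ‖∑ i ∈ Finset.range n, d i • e i‖ := by
        intro t ht
        refine ih _ (fun i hi => ?_) fun i hi his => ?_
        · rcases eq_or_ne i a with rfl | hia
          · simp [ht]
          · rw [Function.update_of_ne hia]
            exact hle i hi
        · rcases eq_or_ne i a with rfl | hia
          · simp [ht]
          · rw [Function.update_of_ne hia]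
            exact hc i hi (by simp [hia, his])
      have h1 := hupd (d a) rfl
      have h2 := hupd (-d a) (abs_neg _)
      obtain ⟨u, hu0, hu1, hu⟩ : ∃ u : ℝ, 0 ≤ u ∧ u ≤ 1 ∧ c a = u * d a + (1 - u) * -d a := by
        rcases eq_or_ne (d a) 0 with hd | hd
        · have := hle a ha
          rw [hd, abs_zero] at this
          exact ⟨0, le_rfl, zero_le_one, by simpa [hd] using this⟩
        · have h3 : |c a / d a| ≤ 1 := by
            rw [abs_div]
            exact div_le_one_of_le₀ (hle a ha) (abs_nonneg _)
          rw [abs_le] at h3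
          refine ⟨(c a / d a + 1) / 2, by linarith, by linarith, ?_⟩
          field_simp
          ring
      have hsum : ∑ i ∈ Finset.range n, c i • e i =
          u • ∑ i ∈ Finset.range n, Function.update c a (d a) i • e i +
            (1 - u) • ∑ i ∈ Finset.range n, Function.update c a (-d a) i • e i := by
        rw [Finset.smul_sum, Finset.smul_sum, ← Finset.sum_add_distrib]
        refine Finset.sum_congr rfl fun i _ => ?_
        rw [smul_smul, smul_smul, ← add_smul]
        congr 1
        rcases eq_or_ne i a with rfl | hia
        · simpa using hu
        · rw [Function.update_of_ne hia, Function.update_of_ne hia]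
          ring
      rw [hsum]
      refine (norm_add_le _ _).trans ?_
      rw [norm_smul, norm_smul, Real.norm_of_nonneg hu0, Real.norm_of_nonneg (by linarith)]
      nlinarith [mul_le_mul_of_nonneg_left h1 hu0,
        mul_le_mul_of_nonneg_left h2 (sub_nonneg.2 hu1)]
  exact key (Finset.range n) c hcd fun i hi hin => absurd (Finset.mem_range.2 hi) hin

theorem norm_sum_le_of_abs_le_mul (h : UniformBlockEquiv D e) (he : Normalized e) {n : ℕ}
    {c d : ℕ → ℝ} {t : ℝ} (ht : 0 ≤ t) (hcd : ∀ i < n, |c i| ≤ t * |d i|) :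
    ‖∑ i ∈ Finset.range n, c i • e i‖ ≤ D * t * ‖∑ i ∈ Finset.range n, d i • e i‖ := by
  have h1 := h.norm_sum_le_of_abs_le he (c := c) (d := fun i => t * d i) (n := n)
    fun i hi => by
      rw [abs_mul, abs_of_nonneg ht]
      exact hcd i hi
  simp only [← smul_smul] at h1
  rw [← Finset.smul_sum, norm_smul, Real.norm_of_nonneg ht, ← mul_assoc] at h1
  exact h1

theorem norm_sum_shift (h : UniformBlockEquiv D e) (he : Normalized e) (a n : ℕ) :
    ‖∑ i ∈ Finset.range n, e (a + i)‖ ≤ D * ‖∑ i ∈ Finset.range n, e i‖ ∧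
      ‖∑ i ∈ Finset.range n, e i‖ ≤ D * ‖∑ i ∈ Finset.range n, e (a + i)‖ := by
  have hγ : SuccBlocks fun i => Finsupp.single (a + i) (1 : ℝ) := by
    refine ⟨fun i => by simp, fun i j hij b hb b' hb' => ?_⟩
    have h1 := Finsupp.support_single_subset hb
    have h2 := Finsupp.support_single_subset hb'
    rw [Finset.mem_singleton] at h1 h2
    omega
  simpa using h.norm_sum_smul_le hγ (fun i => by simp [he (a + i)]) n fun _ => 1

/-- Summing `e` over successive intervals of lengths `k j` amounts, up to a constant, to weighting
`e j` with the norm of a sum of `k j` consecutive terms. -/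
theorem norm_sum_blocks (h : UniformBlockEquiv D e) (he : Normalized e) {C : ℝ}
    (hC : IsCBasic C e) (hD : 0 ≤ D) {k : ℕ → ℕ} (hk : ∀ j, 0 < k j) (m : ℕ) :
    ‖∑ j ∈ Finset.range m, ‖∑ i ∈ Finset.range (k j), e i‖ • e j‖ ≤
        D ^ 3 * ‖∑ i ∈ Finset.range (∑ j ∈ Finset.range m, k j), e i‖ ∧
      ‖∑ i ∈ Finset.range (∑ j ∈ Finset.range m, k j), e i‖ ≤
        D ^ 3 * ‖∑ j ∈ Finset.range m, ‖∑ i ∈ Finset.range (k j), e i‖ • e j‖ := by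
  let p : ℕ → ℕ := fun j => ∑ i ∈ Finset.range j, k i
  have hps : ∀ j, p (j + 1) = p j + k j := fun j => Finset.sum_range_succ _ _
  have hp : StrictMono p := strictMono_nat_of_lt_succ fun j => by
    have := hk j
    have := hps j
    omega
  let β : ℕ → ℕ →₀ ℝ := fun j => ∑ l ∈ Finset.Ico (p j) (p (j + 1)), Finsupp.single l 1
  let w : ℕ → ℝ := fun j => ‖Finsupp.linearCombination ℝ e (β j)‖
  have hβapp : ∀ j l, β j l = if l ∈ Finset.Ico (p j) (p (j + 1)) then 1 else 0 := by
    intro j l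
    simp [β, Finsupp.finsetSum_apply, Finsupp.single_apply]
  have hβ : SuccBlocks β := by
    refine ⟨fun j h0 => ?_, fun i j hij a ha b hb => ?_⟩
    · have h1 := hβapp j (p j)
      rw [if_pos (Finset.mem_Ico.2 ⟨le_rfl, hp (Nat.lt_succ_self j)⟩), h0] at h1
      simp at h1
    · rw [Finsupp.mem_support_iff, hβapp, ite_ne_right_iff, Finset.mem_Ico] at ha hb
      have := hp.monotone (Nat.succ_le_of_lt hij)
      simp only [Nat.succ_eq_add_one] at this
      omega
  have hw : ∀ j, 0 < w j := fun j => norm_pos_iff.2 (hC.linearCombination_ne_zero (hβ.1 j))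
  have hγ : SuccBlocks fun j => (w j)⁻¹ • β j := hβ.smul fun j => inv_ne_zero (hw j).ne'
  have hγ1 : ∀ j, ‖Finsupp.linearCombination ℝ e ((w j)⁻¹ • β j)‖ = 1 := fun j => by
    rw [map_smul, norm_smul, norm_inv, Real.norm_of_nonneg (hw j).le]
    exact inv_mul_cancel₀ (hw j).ne'
  have hmain := h.norm_sum_smul_le hγ hγ1 m w
  have hsum : ∑ j ∈ Finset.range m, w j • Finsupp.linearCombination ℝ e ((w j)⁻¹ • β j) =
      ∑ i ∈ Finset.range (p m), e i := by
    rw [sum_range_eq_sum_blocks hp.monotone (by simp [p])]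
    refine Finset.sum_congr rfl fun j _ => ?_
    rw [map_smul, smul_smul, mul_inv_cancel₀ (hw j).ne', one_smul]
    simp [β]
  rw [hsum] at hmain
  have hwk : ∀ j, w j ≤ D * ‖∑ i ∈ Finset.range (k j), e i‖ ∧
      ‖∑ i ∈ Finset.range (k j), e i‖ ≤ D * w j := by
    intro j
    have h1 : Finsupp.linearCombination ℝ e (β j) = ∑ i ∈ Finset.range (k j), e (p j + i) := by
      simp only [β, map_sum, Finsupp.linearCombination_single, one_smul]
      rw [Finset.sum_Ico_eq_sum_range, hps, Nat.add_sub_cancel_left]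
    simp only [w, h1]
    exact h.norm_sum_shift he (p j) (k j)
  have h1 := h.norm_sum_le_of_abs_le_mul he (n := m) (c := w)
    (d := fun j => ‖∑ i ∈ Finset.range (k j), e i‖) hD fun j _ => by
      rw [abs_of_pos (hw j), abs_norm]
      exact (hwk j).1
  have h2 := h.norm_sum_le_of_abs_le_mul he (n := m) (d := w)
    (c := fun j => ‖∑ i ∈ Finset.range (k j), e i‖) hD fun j _ => by
      rw [abs_of_pos (hw j), abs_norm]
      exact (hwk j).2
  constructor
  · calc _ ≤ D * D * ‖∑ i ∈ Finset.range m, w i • e i‖ := h2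
      _ ≤ D * D * (D * ‖∑ i ∈ Finset.range (p m), e i‖) := by
        gcongr
        exact hmain.2
      _ = D ^ 3 * ‖∑ i ∈ Finset.range (p m), e i‖ := by ring
  · calc _ ≤ D * ‖∑ i ∈ Finset.range m, w i • e i‖ := hmain.1
      _ ≤ D * (D * D * ‖∑ j ∈ Finset.range m, ‖∑ i ∈ Finset.range (k j), e i‖ • e j‖) := by
        gcongr
      _ = D ^ 3 * ‖∑ j ∈ Finset.range m, ‖∑ i ∈ Finset.range (k j), e i‖ • e j‖ := by ring

end UniformBlockEquiv

end BlockSums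

/-! ### Almost multiplicative sequences have power growth -/

section PowerGrowth

theorem le_of_forall_nat_mul_le {x y z : ℝ} (h : ∀ k : ℕ, k * x ≤ k * y + z) : x ≤ y := by
  by_contra! hxy
  have h0 : 0 < x - y := sub_pos.2 hxy
  obtain ⟨k, hk⟩ := exists_nat_gt (z / (x - y))
  have h1 := h k
  rw [div_lt_iff₀ h0] at hk
  linarith

theorem exists_slope_of_almost_additive {f : ℕ → ℝ} {μ : ℝ} (hμ : 0 ≤ μ) (hf1 : f 1 = 0)
    (hmono : ∀ m n, 1 ≤ m → m ≤ n → f m ≤ f n + μ)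
    (hmul : ∀ m n, 1 ≤ m → 1 ≤ n → |f (m * n) - (f m + f n)| ≤ μ)
    (hle : ∀ n, 1 ≤ n → f n ≤ Real.log n) :
    ∃ α : ℝ, 0 ≤ α ∧ α ≤ 1 ∧ ∀ n : ℕ, 1 ≤ n → |f n - α * Real.log n| ≤ μ := by
  have hlog : ∀ n : ℕ, 2 ≤ n → 0 < Real.log n := fun n hn =>
    Real.log_pos (by exact_mod_cast hn)
  have hpow : ∀ n, 1 ≤ n → ∀ k : ℕ, |f (n ^ k) - k * f n| ≤ k * μ := by
    intro n hn k
    induction k with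
    | zero => simp [hf1]
    | succ k ih =>
      have h1 := hmul (n ^ k) n (Nat.one_le_pow _ _ hn) hn
      rw [pow_succ]
      rw [abs_le] at *
      push_cast
      constructor <;> linarith
  have hnonneg : ∀ n, 1 ≤ n → 0 ≤ f n + μ := fun n hn => by
    have := hmono 1 n le_rfl hn
    linarith
  have hcross : ∀ m n : ℕ, 2 ≤ m → 2 ≤ n →
      (f n - μ) / Real.log n ≤ (f m + μ) / Real.log m := by
    intro m n hm hn
    have hlm := hlog m hm
    have hln := hlog n hn
    rw [div_le_div_iff₀ hln hlm]
    refine le_of_forall_nat_mul_le (z := (f m + μ + μ) * Real.log m) fun k => ?_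
    set j := ⌈k * Real.log n / Real.log m⌉₊
    have hj1 : k * Real.log n ≤ j * Real.log m :=
      (div_le_iff₀ hlm).1 (Nat.le_ceil (k * Real.log n / Real.log m))
    have hj2 : j * Real.log m ≤ k * Real.log n + Real.log m := by
      have h1 : (j : ℝ) < k * Real.log n / Real.log m + 1 := Nat.ceil_lt_add_one (by positivity)
      have h2 := mul_le_mul_of_nonneg_right h1.le hlm.le
      rw [add_mul, div_mul_cancel₀ _ hlm.ne', one_mul] at h2
      exact h2
    have hnm : n ^ k ≤ m ^ j := by
      rw [← Nat.cast_le (α := ℝ), ← Real.log_le_log_iff (by positivity) (by positivity)]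
      push_cast
      rw [Real.log_pow, Real.log_pow]
      exact hj1
    have h1 := hmono _ _ (Nat.one_le_pow _ _ (by omega)) hnm
    have h2 := (abs_le.1 (hpow n (by omega) k)).1
    have h3 := (abs_le.1 (hpow m (by omega) j)).2
    have h4 : k * (f n - μ) ≤ j * (f m + μ) + μ := by linarith
    have h5 := mul_le_mul_of_nonneg_right h4 hlm.le
    have h6 := mul_le_mul_of_nonneg_right hj2 (hnonneg m (by omega))
    linarith
  let S : Set ℝ := (fun n : ℕ => (f n - μ) / Real.log n) '' {n | 2 ≤ n}
  have hne : S.Nonempty := ⟨_, 2, show (2 : ℕ) ≤ 2 from le_rfl, rfl⟩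
  have hub : ∀ m : ℕ, 2 ≤ m → (f m + μ) / Real.log m ∈ upperBounds S := by
    rintro m hm _ ⟨n, hn, rfl⟩
    exact hcross m n hm hn
  have hbdd : BddAbove S := ⟨_, hub 2 le_rfl⟩
  have hα1 : ∀ n : ℕ, 1 ≤ n → f n - μ ≤ sSup S * Real.log n := by
    intro n hn
    rcases hn.eq_or_lt with rfl | hn
    · simp [hf1, hμ]
    · exact (div_le_iff₀ (hlog n hn)).1 (le_csSup hbdd ⟨n, hn, rfl⟩)
  have hα2 : ∀ n : ℕ, 1 ≤ n → sSup S * Real.log n ≤ f n + μ := by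
    intro n hn
    rcases hn.eq_or_lt with rfl | hn
    · simp [hf1, hμ]
    · exact (le_div_iff₀ (hlog n hn)).1 (csSup_le hne (hub n hn))
  have hl2 : 0 < Real.log 2 := Real.log_pos one_lt_two
  refine ⟨sSup S, ?_, ?_, fun n hn => ?_⟩
  · have h1 : 0 ≤ sSup S * Real.log 2 := by
      refine le_of_forall_nat_mul_le (z := 2 * μ) fun k => ?_
      have h1 := hα1 (2 ^ k) Nat.one_le_two_pow
      have h2 := hnonneg (2 ^ k) Nat.one_le_two_pow
      push_cast at h1
      rw [Real.log_pow] at h1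
      linarith
    exact nonneg_of_mul_nonneg_left h1 hl2
  · have h1 : sSup S * Real.log 2 ≤ Real.log 2 := by
      refine le_of_forall_nat_mul_le (z := μ) fun k => ?_
      have h1 := hα2 (2 ^ k) Nat.one_le_two_pow
      have h2 := hle (2 ^ k) Nat.one_le_two_pow
      push_cast at h1 h2
      rw [Real.log_pow] at h1 h2
      linarith
    exact le_of_mul_le_mul_right (by linarith) hl2
  · rw [abs_le]
    constructor <;> linarith [hα1 n hn, hα2 n hn]

theorem exists_exponent_of_almost_multiplicative {l : ℕ → ℝ} {M : ℝ} (hM : 1 ≤ M)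
    (hl1 : l 1 = 1) (hmono : ∀ m n, 1 ≤ m → m ≤ n → l m ≤ M * l n)
    (hmul : ∀ m n, 1 ≤ m → 1 ≤ n → l (m * n) ≤ M * (l m * l n) ∧ l m * l n ≤ M * l (m * n))
    (hle : ∀ n, 1 ≤ n → l n ≤ n) :
    ∃ α : ℝ, 0 ≤ α ∧ α ≤ 1 ∧
      ∀ n : ℕ, 1 ≤ n → l n ≤ M * (n : ℝ) ^ α ∧ (n : ℝ) ^ α ≤ M * l n := by
  have hM0 : 0 < M := by linarith
  have hpos : ∀ n, 1 ≤ n → 0 < l n := fun n hn => by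
    have := hmono 1 n le_rfl hn
    rw [hl1] at this
    exact pos_of_mul_pos_right (by linarith) hM0.le
  have hcast : ∀ n : ℕ, 1 ≤ n → 0 < (n : ℝ) := fun n hn => by exact_mod_cast hn
  have hmul1 : ∀ m n, 1 ≤ m → 1 ≤ n → 1 ≤ m * n := fun m n hm hn => Nat.mul_pos hm hn
  obtain ⟨α, h0, h1, h⟩ := exists_slope_of_almost_additive (f := fun n => Real.log (l n))
    (μ := Real.log M) (Real.log_nonneg hM) (by simp [hl1])
    (fun m n hm hmn => by
      have hn := hpos n (hm.trans hmn)
      have h2 := Real.log_le_log (hpos m hm) (hmono m n hm hmn)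
      rw [Real.log_mul hM0.ne' hn.ne'] at h2
      linarith)
    (fun m n hm hn => by
      have hm' := hpos m hm
      have hn' := hpos n hn
      have hmn := hpos _ (hmul1 m n hm hn)
      have h2 := Real.log_le_log hmn (hmul m n hm hn).1
      have h3 := Real.log_le_log (mul_pos hm' hn') (hmul m n hm hn).2
      rw [Real.log_mul hM0.ne' (mul_pos hm' hn').ne', Real.log_mul hm'.ne' hn'.ne'] at h2
      rw [Real.log_mul hM0.ne' hmn.ne', Real.log_mul hm'.ne' hn'.ne'] at h3
      rw [abs_le]
      constructor <;> linarith)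
    (fun n hn => Real.log_le_log (hpos n hn) (hle n hn))
  refine ⟨α, h0, h1, fun n hn => ?_⟩
  have hn' := hcast n hn
  have hp : 0 < (n : ℝ) ^ α := Real.rpow_pos_of_pos hn' α
  have h2 := abs_le.1 (h n hn)
  constructor
  · rw [← Real.log_le_log_iff (hpos n hn) (mul_pos hM0 hp), Real.log_mul hM0.ne' hp.ne',
      Real.log_rpow hn']
    linarith
  · rw [← Real.log_le_log_iff hp (mul_pos hM0 (hpos n hn)),
      Real.log_mul hM0.ne' (hpos n hn).ne', Real.log_rpow hn']
    linarith

end PowerGrowth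

/-! ### Zippin's theorem -/

section Zippin

namespace UniformBlockEquiv

variable {e : ℕ → E} {D : ℝ}

theorem exists_exponent (h : UniformBlockEquiv D e) (he : Normalized e) {C : ℝ}
    (hC : IsCBasic C e) (hD : 1 ≤ D) :
    ∃ α : ℝ, 0 ≤ α ∧ α ≤ 1 ∧ ∀ n : ℕ, 1 ≤ n →
      ‖∑ i ∈ Finset.range n, e i‖ ≤ D ^ 3 * (n : ℝ) ^ α ∧
        (n : ℝ) ^ α ≤ D ^ 3 * ‖∑ i ∈ Finset.range n, e i‖ := by
  have hD0 : 0 ≤ D := by linarith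
  have hD3 : D ≤ D ^ 3 := le_self_pow₀ hD (by norm_num)
  refine exists_exponent_of_almost_multiplicative (l := fun n => ‖∑ i ∈ Finset.range n, e i‖)
    (one_le_pow₀ hD) (by simp [he 0]) (fun m n _ hmn => ?_) (fun m n _ hn => ?_) fun n _ => ?_
  · have h1 := h.norm_sum_le_of_abs_le he (n := n) (c := fun i => if i < m then 1 else 0)
      (d := fun _ => 1) fun i _ => by split_ifs <;> simp
    have h2 : ∑ i ∈ Finset.range n, (if i < m then (1 : ℝ) else 0) • e i =
        ∑ i ∈ Finset.range m, e i := by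
      rw [← Finset.sum_subset (Finset.range_mono hmn) fun i _ hi => by
        rw [if_neg (by simpa using hi), zero_smul]]
      refine Finset.sum_congr rfl fun i hi => ?_
      rw [if_pos (Finset.mem_range.1 hi), one_smul]
    rw [h2] at h1
    simp only [one_smul] at h1
    refine h1.trans ?_
    gcongr
  · have h1 := h.norm_sum_blocks he hC hD0 (k := fun _ => n) (fun _ => hn) m
    rw [← Finset.smul_sum, norm_smul, norm_norm, Finset.sum_const, Finset.card_range,
      smul_eq_mul, mul_comm ‖_‖] at h1
    exact h1.symm
  · refine (norm_sum_le _ _).trans ?_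
    simp [he _]

theorem equivToC0Basis (h : UniformBlockEquiv D e) (he : Normalized e) {C : ℝ}
    (hC : IsCBasic C e) (hD : 1 ≤ D) {L : ℝ}
    (hL : ∀ n, ‖∑ i ∈ Finset.range n, e i‖ ≤ L) : EquivToC0Basis e := by
  have hC1 := hC.one_le
  have hL0 : 1 ≤ L := by simpa [he 0] using hL 1
  have hD0 : 0 ≤ D := by linarith
  refine ⟨2 * C, D * L, by linarith, by positivity, fun n c => ⟨?_, ?_⟩⟩
  · rw [inv_mul_le_iff₀ (by linarith)]
    refine Real.iSup_le (fun i => Real.iSup_le (fun hi => ?_) (by positivity)) (by positivity)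
    have h1 := hC.abs_coeff_le (coeffBelow n c) i
    rwa [linearCombination_coeffBelow, he i, mul_one, coeffBelow_apply,
      if_pos (Finset.mem_range.1 hi)] at h1
  · set s := ⨆ i ∈ Finset.range n, |c i|
    have hs0 : 0 ≤ s := Real.iSup_nonneg fun i => Real.iSup_nonneg fun _ => abs_nonneg _
    have hbdd : BddAbove (Set.range fun i => ⨆ _ : i ∈ Finset.range n, |c i|) := by
      refine ⟨∑ i ∈ Finset.range n, |c i|, ?_⟩
      rintro _ ⟨i, rfl⟩
      exact Real.iSup_le (fun hi => Finset.single_le_sum (f := fun i => |c i|)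
        (fun _ _ => abs_nonneg _) hi) (Finset.sum_nonneg fun _ _ => abs_nonneg _)
    have hcs : ∀ i < n, |c i| ≤ s := by
      intro i hi
      have h1 := le_ciSup hbdd i
      have hi' : i ∈ Finset.range n := Finset.mem_range.2 hi
      simp only [hi', ciSup_unique] at h1
      exact h1
    have h1 := h.norm_sum_le_of_abs_le_mul he (n := n) (c := c) (d := fun _ => 1) hs0
      fun i hi => by simpa using hcs i hi
    simp only [one_smul] at h1
    calc _ ≤ D * s * ‖∑ i ∈ Finset.range n, e i‖ := h1
      _ ≤ D * s * L := by
        gcongr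
        exact hL n
      _ = D * L * s := by ring

theorem norm_sum_rpow (h : UniformBlockEquiv D e) (he : Normalized e) {C : ℝ}
    (hC : IsCBasic C e) (hD : 1 ≤ D) {α : ℝ} (hα : 0 < α)
    (hg : ∀ n : ℕ, 1 ≤ n → ‖∑ i ∈ Finset.range n, e i‖ ≤ D ^ 3 * (n : ℝ) ^ α ∧
      (n : ℝ) ^ α ≤ D ^ 3 * ‖∑ i ∈ Finset.range n, e i‖)
    {k : ℕ → ℕ} (hk : ∀ j, 0 < k j) (m : ℕ) :
    ‖∑ j ∈ Finset.range m, ((k j : ℝ) ^ α) • e j‖ ≤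
        D ^ 10 * (∑ j ∈ Finset.range m, (k j : ℝ)) ^ α ∧
      (∑ j ∈ Finset.range m, (k j : ℝ)) ^ α ≤
        D ^ 10 * ‖∑ j ∈ Finset.range m, ((k j : ℝ) ^ α) • e j‖ := by
  have hD0 : 0 ≤ D := by linarith
  rcases Nat.eq_zero_or_pos m with rfl | hm
  · simp [Real.zero_rpow hα.ne']
  have hS := hg (∑ j ∈ Finset.range m, k j)
    (Finset.sum_pos (fun j _ => hk j) ⟨0, Finset.mem_range.2 hm⟩)
  have hb := h.norm_sum_blocks he hC hD0 hk m
  have habs : ∀ j, |(k j : ℝ) ^ α| = (k j : ℝ) ^ α := fun j => abs_of_nonneg (by positivity)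
  have h1 := h.norm_sum_le_of_abs_le_mul he (n := m) (c := fun j => (k j : ℝ) ^ α)
    (d := fun j => ‖∑ i ∈ Finset.range (k j), e i‖) (pow_nonneg hD0 3) fun j _ => by
      rw [habs, abs_norm]
      exact (hg _ (hk j)).2
  have h2 := h.norm_sum_le_of_abs_le_mul he (n := m) (d := fun j => (k j : ℝ) ^ α)
    (c := fun j => ‖∑ i ∈ Finset.range (k j), e i‖) (pow_nonneg hD0 3) fun j _ => by
      rw [habs, abs_norm]
      exact (hg _ (hk j)).1
  push_cast at hS
  constructor
  · calc _ ≤ D * D ^ 3 * ‖∑ j ∈ Finset.range m, ‖∑ i ∈ Finset.range (k j), e i‖ • e j‖ := h1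
      _ ≤ D * D ^ 3 * (D ^ 3 * (D ^ 3 * (∑ j ∈ Finset.range m, (k j : ℝ)) ^ α)) := by
        gcongr
        refine hb.1.trans ?_
        gcongr
        exact hS.1
      _ = _ := by ring
  · calc _ ≤ D ^ 3 * ‖∑ i ∈ Finset.range (∑ j ∈ Finset.range m, k j), e i‖ := hS.2
      _ ≤ D ^ 3 * (D ^ 3 * (D * D ^ 3 * ‖∑ j ∈ Finset.range m, ((k j : ℝ) ^ α) • e j‖)) := by
        gcongr
        refine hb.2.trans ?_
        gcongr
      _ = _ := by ring

theorem equivToLpBasis (h : UniformBlockEquiv D e) (he : Normalized e) {C : ℝ}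
    (hC : IsCBasic C e) (hD : 1 ≤ D) {α : ℝ} (hα : 0 < α)
    (hg : ∀ n : ℕ, 1 ≤ n → ‖∑ i ∈ Finset.range n, e i‖ ≤ D ^ 3 * (n : ℝ) ^ α ∧
      (n : ℝ) ^ α ≤ D ^ 3 * ‖∑ i ∈ Finset.range n, e i‖) :
    EquivToLpBasis (1 / α) e := by
  have hD0 : 0 < D := by linarith
  have key : ∀ (m : ℕ) (c : ℕ → ℝ),
      ‖∑ j ∈ Finset.range m, |c j| • e j‖ ≤
        D ^ 10 * (∑ j ∈ Finset.range m, |c j| ^ (1 / α)) ^ α ∧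
      (∑ j ∈ Finset.range m, |c j| ^ (1 / α)) ^ α ≤
        D ^ 10 * ‖∑ j ∈ Finset.range m, |c j| • e j‖ := by
    intro m c
    let k : ℕ → ℕ → ℕ := fun K j => ⌊|c j| ^ (1 / α) * K⌋₊ + 1
    have hlim : ∀ j, Tendsto (fun K : ℕ => (k K j : ℝ) / K) atTop (𝓝 (|c j| ^ (1 / α))) := by
      intro j
      have h1 := (tendsto_nat_floor_mul_div_atTop (R := ℝ)
        (a := |c j| ^ (1 / α)) (by positivity)).comp tendsto_natCast_atTop_atTop
      have h2 := h1.add tendsto_one_div_atTop_nhds_zero_nat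
      rw [add_zero] at h2
      refine h2.congr fun K => ?_
      simp only [Function.comp, k]
      push_cast
      ring
    have hlim1 : Tendsto (fun K : ℕ => (∑ j ∈ Finset.range m, (k K j : ℝ) / K) ^ α) atTop
        (𝓝 ((∑ j ∈ Finset.range m, |c j| ^ (1 / α)) ^ α)) :=
      (tendsto_finsetSum _ fun j _ => hlim j).rpow_const (Or.inr hα.le)
    have hlim2 : Tendsto (fun K : ℕ => ‖∑ j ∈ Finset.range m, ((k K j : ℝ) / K) ^ α • e j‖) atTop
        (𝓝 ‖∑ j ∈ Finset.range m, |c j| • e j‖) := by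
      refine (tendsto_finsetSum _ fun j _ => Tendsto.smul_const ?_ (e j)).norm
      have h1 := (hlim j).rpow_const (p := α) (Or.inr hα.le)
      rwa [← Real.rpow_mul (abs_nonneg _), one_div_mul_cancel hα.ne', Real.rpow_one] at h1
    have hK : ∀ K : ℕ,
        ‖∑ j ∈ Finset.range m, ((k K j : ℝ) / K) ^ α • e j‖ =
          ((K : ℝ) ^ α)⁻¹ * ‖∑ j ∈ Finset.range m, ((k K j : ℝ) ^ α) • e j‖ ∧
        (∑ j ∈ Finset.range m, (k K j : ℝ) / K) ^ α =
          ((K : ℝ) ^ α)⁻¹ * (∑ j ∈ Finset.range m, (k K j : ℝ)) ^ α := by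
      intro K
      constructor
      · rw [← Real.norm_of_nonneg (show 0 ≤ ((K : ℝ) ^ α)⁻¹ by positivity), ← norm_smul,
          Finset.smul_sum]
        congr 1
        refine Finset.sum_congr rfl fun j _ => ?_
        rw [smul_smul, Real.div_rpow (by positivity) (by positivity), div_eq_inv_mul]
      · rw [← Finset.sum_div, Real.div_rpow (by positivity) (by positivity), div_eq_inv_mul]
    have hb := fun K : ℕ => h.norm_sum_rpow he hC hD hα hg (k := k K)
      (fun j => Nat.succ_pos _) m
    constructor
    · refine le_of_tendsto_of_tendsto' hlim2 (hlim1.const_mul _) fun K => ?_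
      rw [(hK K).1, (hK K).2, mul_left_comm]
      gcongr
      exact (hb K).1
    · refine le_of_tendsto_of_tendsto' hlim1 (hlim2.const_mul _) fun K => ?_
      rw [(hK K).1, (hK K).2, mul_left_comm]
      gcongr
      exact (hb K).2
  refine ⟨D ^ 11, D ^ 11, by positivity, by positivity, fun n c => ?_⟩
  rw [one_div_one_div]
  have h1 := key n c
  have h2 := h.norm_sum_le_of_abs_eq he (n := n) (c := c) (d := fun j => |c j|) fun i _ => by simp
  have h3 := h.norm_sum_le_of_abs_eq he (n := n) (d := c) (c := fun j => |c j|) fun i _ => by simp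
  constructor
  · rw [inv_mul_le_iff₀ (by positivity)]
    calc _ ≤ _ := h1.2
      _ ≤ D ^ 10 * (D * ‖∑ i ∈ Finset.range n, c i • e i‖) := by gcongr
      _ = _ := by ring
  · calc _ ≤ _ := h2
      _ ≤ D * (D ^ 10 * (∑ j ∈ Finset.range n, |c j| ^ (1 / α)) ^ α) := by
        gcongr
        exact h1.1
      _ = _ := by ring

theorem equivToC0Basis_or_equivToLpBasis (h : UniformBlockEquiv D e) (he : Normalized e) {C : ℝ}
    (hC : IsCBasic C e) (hD : 1 ≤ D) :
    EquivToC0Basis e ∨ ∃ p : ℝ, 1 ≤ p ∧ EquivToLpBasis p e := by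
  obtain ⟨α, hα0, hα1, hg⟩ := h.exists_exponent he hC hD
  rcases hα0.eq_or_lt with rfl | hα
  · refine Or.inl (h.equivToC0Basis he hC hD (L := D ^ 3) fun n => ?_)
    rcases Nat.eq_zero_or_pos n with rfl | hn
    · simpa using pow_nonneg (zero_le_one.trans hD) 3
    · simpa using (hg n hn).1
  · exact Or.inr ⟨1 / α, one_le_one_div hα hα1, h.equivToLpBasis he hC hD hα hg⟩

end UniformBlockEquiv

end Zippin

/-- Remark 3.6 (3.7): if all asymptotic models of `X` generated by block basic arrays are
equivalent, then each of them is equivalent to the unit vector basis of `c₀` or of `ℓ_p`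
for some `1 ≤ p < ∞`. -/
theorem stmt_6 {X : Type*} [NormedAddCommGroup X] [NormedSpace ℝ X] [CompleteSpace X]
    (b : ℕ → X) (hb : IsSchauderBasis b)
    (huniq : ∀ (E₁ E₂ : Type) [NormedAddCommGroup E₁] [NormedSpace ℝ E₁]
      [NormedAddCommGroup E₂] [NormedSpace ℝ E₂] (e : ℕ → E₁) (f : ℕ → E₂),
      IsBlockGeneratedAsymptoticModel b e → IsBlockGeneratedAsymptoticModel b f →
        SeqEquiv e f) :
    ∀ (E : Type) [NormedAddCommGroup E] [NormedSpace ℝ E] (e : ℕ → E),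
      IsBlockGeneratedAsymptoticModel b e →
        EquivToC0Basis e ∨ ∃ p : ℝ, 1 ≤ p ∧ EquivToLpBasis p e := by
  intro E _ _ e he
  obtain ⟨⟨C, hC⟩, -⟩ := hb
  obtain ⟨B, hB⟩ := he.2.1
  obtain ⟨D, hD, h⟩ := exists_uniformBlockEquiv he.1 hB fun γ hγ hγ1 =>
    huniq E E e _ he (isBlockGenerated_of_isBlockBasisOf hC he hγ1 (hγ.isBlockBasisOf hB))
  exact h.equivToC0Basis_or_equivToLpBasis he.1 hB hD
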